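/- arXiv:1605.01373 — 9 statements merged into one kernel-verified Lean document; each statement's English description precedes it below -/
import Mathlib

section
/- Let X be a nonzero matrix with nonnegative integer entries such that both X·Xᵀ and Xᵀ·X are irreducible and the largest eigenvalue of X·Xᵀ is strictly less than 4. Then X can be transformed, by a permutation of its rows together with an independent permutation of its columns, into one of the following: a staircase matrix; an extended staircase matrix; one of the matrices X₁ = [[1,0,0],[1,1,1],[0,0,1]], X₂ = [[1,1,0,0],[0,1,1,1],[0,0,0,1]], X₃ = [[1,0,0,0],[1,1,0,0],[0,1,1,1],[0,0,0,1]]; or the transpose of one of these. -/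
open Matrix

/-- `μ` is an eigenvalue of the real square matrix `A` (with a real eigenvector). -/
def hasEigen {n : ℕ} (A : Matrix (Fin n) (Fin n) ℝ) (μ : ℝ) : Prop :=
  ∃ v : Fin n → ℝ, v ≠ 0 ∧ A.mulVec v = μ • v

/-- A square nonnegative matrix is irreducible if for every pair of indices `(i,j)` some
power of the matrix has strictly positive `(i,j)` entry. -/
def IsIrreducibleMat {n : ℕ} (A : Matrix (Fin n) (Fin n) ℝ) : Prop :=
  ∀ i j : Fin n, ∃ m : ℕ, 1 ≤ m ∧ 0 < (A ^ m) i j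

/-- `X` can be transformed into `Y` by a permutation of rows together with an independent
permutation of columns. -/
def PermEquiv {p q r s : ℕ} (X : Matrix (Fin p) (Fin q) ℝ)
    (Y : Matrix (Fin r) (Fin s) ℝ) : Prop :=
  ∃ (e : Fin p ≃ Fin r) (f : Fin q ≃ Fin s), ∀ i j, X i j = Y (e i) (f j)

/-- The `k × k` staircase matrix: entry `1` exactly when `j = i` or `j = i + 1`. -/
def stairSq (k : ℕ) : Matrix (Fin k) (Fin k) ℝ :=
  Matrix.of fun i j => if (j : ℕ) = (i : ℕ) ∨ (j : ℕ) = (i : ℕ) + 1 then 1 else 0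

/-- The `k × (k+1)` staircase matrix: entry `1` exactly when `j = i` or `j = i + 1`. -/
def stairRect (k : ℕ) : Matrix (Fin k) (Fin (k + 1)) ℝ :=
  Matrix.of fun i j => if (j : ℕ) = (i : ℕ) ∨ (j : ℕ) = (i : ℕ) + 1 then 1 else 0

/-- `X` is a staircase matrix, up to independent permutations of rows and columns. -/
def IsStaircase {p q : ℕ} (X : Matrix (Fin p) (Fin q) ℝ) : Prop :=
  ∃ k : ℕ, 1 ≤ k ∧
    (PermEquiv X (stairSq k) ∨ PermEquiv X (stairSq k)ᵀ ∨
     PermEquiv X (stairRect k) ∨ PermEquiv X (stairRect k)ᵀ)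

/-- The `(k+1) × k` matrix with rows `e₁+e₂, e₂+e₃, …, e_{k−1}+e_k, e_k, e_k`
(written `0`-indexed). -/
def extA (k : ℕ) : Matrix (Fin (k + 1)) (Fin k) ℝ :=
  Matrix.of fun i j =>
    if ((i : ℕ) + 1 < k ∧ ((j : ℕ) = (i : ℕ) ∨ (j : ℕ) = (i : ℕ) + 1)) ∨
       (k ≤ (i : ℕ) + 1 ∧ (j : ℕ) + 1 = k) then 1 else 0

/-- The `k × (k+2)` matrix with rows `e₁+e₂, e₂+e₃, …, e_{k−1}+e_k, e_k+e_{k+1}+e_{k+2}`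
(written `0`-indexed). -/
def extB (k : ℕ) : Matrix (Fin k) (Fin (k + 2)) ℝ :=
  Matrix.of fun i j =>
    if ((i : ℕ) + 1 < k ∧ ((j : ℕ) = (i : ℕ) ∨ (j : ℕ) = (i : ℕ) + 1)) ∨
       ((i : ℕ) + 1 = k ∧ ((j : ℕ) + 1 = k ∨ (j : ℕ) = k ∨ (j : ℕ) = k + 1)) then 1 else 0

/-- `X` is an extended staircase matrix: it is obtained from `extA k` or `extB k` by
permutations of rows, permutations of columns and/or transposition. -/
def IsExtStaircase {p q : ℕ} (X : Matrix (Fin p) (Fin q) ℝ) : Prop :=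
  ∃ k : ℕ, 1 ≤ k ∧
    (PermEquiv X (extA k) ∨ PermEquiv X (extA k)ᵀ ∨
     PermEquiv X (extB k) ∨ PermEquiv X (extB k)ᵀ)

def Xone : Matrix (Fin 3) (Fin 3) ℝ := !![1,0,0; 1,1,1; 0,0,1]

def Xtwo : Matrix (Fin 3) (Fin 4) ℝ := !![1,1,0,0; 0,1,1,1; 0,0,0,1]

def Xthree : Matrix (Fin 4) (Fin 4) ℝ := !![1,0,0,0; 1,1,0,0; 0,1,1,1; 0,0,0,1]

/-- Every nonzero `ℕ`-valued function `z` on the vertices has a support vertex at which `2 z`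
exceeds the sum of `z` over the neighbours (and hence over every finite set of neighbours). -/
def NoSubharmonic {V : Type*} (G : SimpleGraph V) : Prop :=
  ∀ z : V → ℕ, (∃ v, z v ≠ 0) →
    ∃ v, z v ≠ 0 ∧ ∀ S : Finset V, (∀ y ∈ S, G.Adj v y) → ∑ y ∈ S, z y < 2 * z v

/-- `f 0, …, f n` are the distinct consecutive vertices of a path. -/
structure IsPathSeq {V : Type*} (G : SimpleGraph V) (f : ℕ → V) (n : ℕ) : Prop where
  inj : ∀ a ≤ n, ∀ b ≤ n, f a = f b → a = b
  adj : ∀ a < n, G.Adj (f a) (f (a + 1))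

section Graph

variable {V : Type*} {G : SimpleGraph V}

lemma NoSubharmonic.false_of_labels (hG : NoSubharmonic G) {h : ℕ → V} {D : Finset ℕ}
    (hD : D.Nonempty) (hinj : ∀ a ∈ D, ∀ b ∈ D, h a = h b → a = b) (δ : ℕ → ℕ)
    (hpos : ∀ a ∈ D, 0 < δ a)
    (hN : ∀ a ∈ D, ∃ S ⊆ D, (∀ b ∈ S, G.Adj (h a) (h b)) ∧ 2 * δ a ≤ ∑ b ∈ S, δ b) : False := by
  classical
  let z : V → ℕ := fun v => ∑ a ∈ D with h a = v, δ a
  have hz : ∀ a ∈ D, z (h a) = δ a := by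
    intro a ha
    have : D.filter (fun b => h b = h a) = {a} := by
      ext b
      simp only [Finset.mem_filter, Finset.mem_singleton]
      exact ⟨fun hb => hinj b hb.1 a ha hb.2, fun hb => by subst hb; exact ⟨ha, rfl⟩⟩
    simp [z, this]
  obtain ⟨a₀, ha₀⟩ := hD
  obtain ⟨v, hv, hS⟩ := hG z ⟨h a₀, by rw [hz a₀ ha₀]; exact (hpos a₀ ha₀).ne'⟩
  obtain ⟨a, hmem, -⟩ := Finset.exists_ne_zero_of_sum_ne_zero hv
  obtain ⟨ha, rfl⟩ := Finset.mem_filter.1 hmem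
  obtain ⟨S, hSD, hadj, hle⟩ := hN a ha
  have key := hS (S.image h) (by simpa using hadj)
  rw [Finset.sum_image (fun b hb c hc => hinj b (hSD hb) c (hSD hc)),
    Finset.sum_congr rfl (fun b hb => hz b (hSD hb)), hz a ha] at key
  exact lt_irrefl _ (hle.trans_lt key)

namespace IsPathSeq

variable {f : ℕ → V} {n : ℕ}

lemma reverse (hf : IsPathSeq G f n) : IsPathSeq G (fun a => f (n - a)) n where
  inj a ha b hb h := by
    have := hf.inj _ (Nat.sub_le n a) _ (Nat.sub_le n b) h
    omega
  adj a ha := by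
    have := (hf.adj (n - (a + 1)) (by omega)).symm
    rwa [show n - (a + 1) + 1 = n - a by omega] at this

lemma mono (hf : IsPathSeq G f n) {m : ℕ} (hm : m ≤ n) : IsPathSeq G f m where
  inj a ha b hb h := hf.inj a (ha.trans hm) b (hb.trans hm) h
  adj a ha := hf.adj a (ha.trans_le hm)

lemma append (hf : IsPathSeq G f n) {y : V} (hy : ∀ a ≤ n, f a ≠ y) (hadj : G.Adj (f n) y) :
    IsPathSeq G (fun a => if a ≤ n then f a else y) (n + 1) where
  inj a ha b hb h := by
    split_ifs at h with h1 h2 h2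
    · exact hf.inj a h1 b h2 h
    · exact absurd h (hy a h1)
    · exact absurd h.symm (hy b h2)
    · omega
  adj a ha := by
    rw [if_pos (by omega)]
    split_ifs with h1
    · exact hf.adj a (by omega)
    · rwa [show a = n by omega]

lemma adj_pred (hf : IsPathSeq G f n) {a : ℕ} (h0 : 0 < a) (ha : a ≤ n) :
    G.Adj (f a) (f (a - 1)) := by
  have := (hf.adj (a - 1) (by omega)).symm
  rwa [show a - 1 + 1 = a by omega] at this

lemma not_adj_of_add_two_le (hf : IsPathSeq G f n) (hG : NoSubharmonic G) {i j : ℕ}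
    (hij : i + 2 ≤ j) (hj : j ≤ n) : ¬ G.Adj (f i) (f j) := by
  intro hadj
  refine hG.false_of_labels (h := f) (D := Finset.Icc i j) ⟨i, by simp; omega⟩ ?_ (fun _ => 1)
    (by simp) ?_
  · intro a ha b hb
    rw [Finset.mem_Icc] at ha hb
    exact hf.inj a (by omega) b (by omega)
  · intro a ha
    rw [Finset.mem_Icc] at ha
    rcases eq_or_ne a i with rfl | hai
    · refine ⟨{a + 1, j}, ?_, ?_, ?_⟩
      · simp [Finset.insert_subset_iff]; omega
      · simpa using ⟨hf.adj a (by omega), hadj⟩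
      · rw [Finset.sum_pair (by omega)]
    · rcases eq_or_ne a j with rfl | haj
      · refine ⟨{i, a - 1}, ?_, ?_, ?_⟩
        · simp [Finset.insert_subset_iff]; omega
        · simpa using ⟨hadj.symm, hf.adj_pred (by omega) hj⟩
        · rw [Finset.sum_pair (by omega)]
      · refine ⟨{a + 1, a - 1}, ?_, ?_, ?_⟩
        · simp [Finset.insert_subset_iff]; omega
        · simpa using ⟨hf.adj a (by omega), hf.adj_pred (by omega) (by omega)⟩
        · rw [Finset.sum_pair (by omega)]

lemma adj_iff (hf : IsPathSeq G f n) (hG : NoSubharmonic G) {a b : ℕ} (ha : a ≤ n) (hb : b ≤ n) :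
    G.Adj (f a) (f b) ↔ a + 1 = b ∨ b + 1 = a := by
  constructor
  · intro h
    by_contra hne
    rcases lt_trichotomy a b with hab | rfl | hab
    · exact hf.not_adj_of_add_two_le hG (by omega) hb h
    · exact G.irrefl h
    · exact hf.not_adj_of_add_two_le hG (by omega) ha h.symm
  · rintro (rfl | rfl)
    · exact hf.adj a (by omega)
    · exact (hf.adj b (by omega)).symm

end IsPathSeq

/-- A path together with one extra vertex `h (n + 1)` off the path, attached at position `i`. -/
structure IsBranchSeq (G : SimpleGraph V) (h : ℕ → V) (n i : ℕ) : Prop where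
  path : IsPathSeq G h n
  off : ∀ a ≤ n, h a ≠ h (n + 1)
  adj : G.Adj (h i) (h (n + 1))
  le : i ≤ n

namespace IsBranchSeq

variable {h : ℕ → V} {n i : ℕ}

lemma inj (hb : IsBranchSeq G h n i) : ∀ a ≤ n + 1, ∀ b ≤ n + 1, h a = h b → a = b := by
  intro a ha b hb' hab
  rcases eq_or_ne a (n + 1) with rfl | h1 <;> rcases eq_or_ne b (n + 1) with rfl | h2
  · rfl
  · exact absurd hab.symm (hb.off b (by omega))
  · exact absurd hab (hb.off a (by omega))
  · exact hb.path.inj a (by omega) b (by omega) hab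

lemma not_adj_of_lt (hb : IsBranchSeq G h n i) (hG : NoSubharmonic G) {j : ℕ} (hij : i < j)
    (hj : j ≤ n) : ¬ G.Adj (h j) (h (n + 1)) := by
  intro hadj
  refine hG.false_of_labels (h := h) (D := insert (n + 1) (Finset.Icc i j)) ⟨n + 1, by simp⟩ ?_
    (fun _ => 1) (by simp) ?_
  · intro a ha b hb'
    rw [Finset.mem_insert, Finset.mem_Icc] at ha hb'
    exact hb.inj a (by omega) b (by omega)
  · intro a ha
    rw [Finset.mem_insert, Finset.mem_Icc] at ha
    rcases eq_or_ne a (n + 1) with rfl | han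
    · refine ⟨{i, j}, ?_, ?_, ?_⟩
      · simp [Finset.insert_subset_iff]; omega
      · simpa using ⟨hb.adj.symm, hadj.symm⟩
      · rw [Finset.sum_pair (by omega)]
    rcases eq_or_ne a i with rfl | hai
    · refine ⟨{a + 1, n + 1}, ?_, ?_, ?_⟩
      · simp [Finset.insert_subset_iff]; omega
      · simpa using ⟨hb.path.adj a (by omega), hb.adj⟩
      · rw [Finset.sum_pair (by omega)]
    · rcases eq_or_ne a j with rfl | haj
      · refine ⟨{n + 1, a - 1}, ?_, ?_, ?_⟩
        · simp [Finset.insert_subset_iff]; omega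
        · simpa using ⟨hadj, hb.path.adj_pred (by omega) hj⟩
        · rw [Finset.sum_pair (by omega)]
      · refine ⟨{a + 1, a - 1}, ?_, ?_, ?_⟩
        · simp [Finset.insert_subset_iff]; omega
        · simpa using ⟨hb.path.adj a (by omega), hb.path.adj_pred (by omega) (by omega)⟩
        · rw [Finset.sum_pair (by omega)]

lemma adj_iff (hb : IsBranchSeq G h n i) (hG : NoSubharmonic G) {j : ℕ} (hj : j ≤ n) :
    G.Adj (h j) (h (n + 1)) ↔ j = i := by
  refine ⟨fun hadj => ?_, fun hji => hji ▸ hb.adj⟩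
  rcases lt_trichotomy i j with hij | rfl | hij
  · exact absurd hadj (hb.not_adj_of_lt hG hij hj)
  · rfl
  · have hb' : IsBranchSeq G h n j := ⟨hb.path, hb.off, hadj, hj⟩
    exact absurd hb.adj (hb'.not_adj_of_lt hG hij hb.le)

lemma adj_iff_of_le (hb : IsBranchSeq G h n i) (hG : NoSubharmonic G) {a b : ℕ} (ha : a ≤ n + 1)
    (hb' : b ≤ n + 1) :
    G.Adj (h a) (h b) ↔ (a ≤ n ∧ b ≤ n ∧ (a + 1 = b ∨ b + 1 = a)) ∨ (a = i ∧ b = n + 1) ∨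
      (a = n + 1 ∧ b = i) := by
  have hi := hb.le
  rcases eq_or_ne a (n + 1) with rfl | h1 <;> rcases eq_or_ne b (n + 1) with rfl | h2
  · simp only [SimpleGraph.irrefl, false_iff]
    omega
  · rw [G.adj_comm, hb.adj_iff hG (by omega)]
    omega
  · rw [hb.adj_iff hG (by omega)]
    omega
  · rw [hb.path.adj_iff hG (by omega) (by omega)]
    omega

lemma reverse (hb : IsBranchSeq G h n i) :
    IsBranchSeq G (fun a => if a ≤ n then h (n - a) else h (n + 1)) n (n - i) where
  path := by
    have hr := hb.path.reverse
    refine ⟨fun a ha b hb' hab => ?_, fun a ha => ?_⟩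
    · simp only [if_pos ha, if_pos hb'] at hab
      exact hr.inj a ha b hb' hab
    · simp only [if_pos ha.le, if_pos (show a + 1 ≤ n from ha)]
      exact hr.adj a ha
  off a ha := by
    simpa [ha] using hb.off (n - a) (by omega)
  adj := by
    have := hb.adj
    have hle := hb.le
    simpa [Nat.sub_sub_self hle] using this
  le := by omega

/-- The legs of lengths `1, 3, 3` do not fit. -/
lemma not_three_le (hb : IsBranchSeq G h n i) (hG : NoSubharmonic G) (hi : 3 ≤ i) (hn : i + 3 ≤ n) :
    False := by
  obtain ⟨k, rfl⟩ : ∃ k, i = k + 3 := ⟨i - 3, by omega⟩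
  refine hG.false_of_labels (h := h) (D := insert (n + 1) (Finset.Icc k (k + 6)))
    ⟨n + 1, by simp⟩ ?_
    (fun a => if a = n + 1 then 2 else if a ≤ k + 3 then a - k + 1 else k + 7 - a) ?_ ?_
  · intro a ha b hb'
    rw [Finset.mem_insert, Finset.mem_Icc] at ha hb'
    exact hb.inj a (by omega) b (by omega)
  · intro a ha
    rw [Finset.mem_insert, Finset.mem_Icc] at ha
    split_ifs <;> omega
  · intro a ha
    rw [Finset.mem_insert, Finset.mem_Icc] at ha
    by_cases h1 : a = n + 1
    · refine ⟨{k + 3}, by simp, by simpa [h1] using hb.adj.symm, ?_⟩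
      simp [h1]; split_ifs <;> omega
    by_cases h2 : a = k
    · refine ⟨{k + 1}, by simp, ?_, ?_⟩
      · subst h2; simpa using hb.path.adj a (by omega)
      · simp; split_ifs <;> omega
    by_cases h3 : a = k + 6
    · refine ⟨{k + 5}, by simp, ?_, ?_⟩
      · subst h3; simpa using hb.path.adj_pred (a := k + 6) (by omega) (by omega)
      · simp; split_ifs <;> omega
    by_cases h4 : a = k + 3
    · refine ⟨{k + 2, k + 4, n + 1}, ?_, ?_, ?_⟩
      · simp [Finset.insert_subset_iff]
      · subst h4
        simpa using ⟨hb.path.adj_pred (a := k + 3) (by omega) (by omega),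
          hb.path.adj (k + 3) (by omega), hb.adj⟩
      · rw [Finset.sum_insert (by simp; omega), Finset.sum_pair (by omega)]
        split_ifs <;> omega
    · refine ⟨{a - 1, a + 1}, ?_, ?_, ?_⟩
      · simp [Finset.insert_subset_iff]; omega
      · simpa using ⟨hb.path.adj_pred (by omega) (by omega), hb.path.adj a (by omega)⟩
      · rw [Finset.sum_pair (by omega)]
        split_ifs <;> omega

/-- The legs of lengths `1, 2, 5` do not fit. -/
lemma lt_seven (hb : IsBranchSeq G h n 2) (hG : NoSubharmonic G) : n < 7 := by
  by_contra! hn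
  refine hG.false_of_labels (h := h) (D := insert (n + 1) (Finset.Icc 0 7))
    ⟨n + 1, by simp⟩ ?_
    (fun a => if a = n + 1 then 3 else if a ≤ 2 then 2 * a + 2 else 8 - a) ?_ ?_
  · intro a ha b hb'
    rw [Finset.mem_insert, Finset.mem_Icc] at ha hb'
    exact hb.inj a (by omega) b (by omega)
  · intro a ha
    rw [Finset.mem_insert, Finset.mem_Icc] at ha
    split_ifs <;> omega
  · intro a ha
    rw [Finset.mem_insert, Finset.mem_Icc] at ha
    by_cases h1 : a = n + 1
    · refine ⟨{2}, by simp, by simpa [h1] using hb.adj.symm, ?_⟩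
      simp [h1]; split_ifs <;> omega
    by_cases h2 : a = 0
    · refine ⟨{1}, by simp, ?_, ?_⟩
      · subst h2; simpa using hb.path.adj 0 (by omega)
      · simp; split_ifs <;> omega
    by_cases h3 : a = 7
    · refine ⟨{6}, by simp, ?_, ?_⟩
      · subst h3; simpa using hb.path.adj_pred (a := 7) (by omega) (by omega)
      · simp; split_ifs <;> omega
    by_cases h4 : a = 2
    · refine ⟨{1, 3, n + 1}, ?_, ?_, ?_⟩
      · simp [Finset.insert_subset_iff]
      · subst h4
        simpa using ⟨hb.path.adj_pred (a := 2) (by omega) (by omega),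
          hb.path.adj 2 (by omega), hb.adj⟩
      · rw [Finset.sum_insert (by simp; omega), Finset.sum_pair (by omega)]
        split_ifs <;> omega
    · refine ⟨{a - 1, a + 1}, ?_, ?_, ?_⟩
      · simp [Finset.insert_subset_iff]; omega
      · simpa using ⟨hb.path.adj_pred (by omega) (by omega), hb.path.adj a (by omega)⟩
      · rw [Finset.sum_pair (by omega)]
        split_ifs <;> omega

end IsBranchSeq

namespace IsPathSeq

variable {f : ℕ → V} {n : ℕ}

/-- Two further vertices cannot both be attached at interior positions of a path. -/
lemma not_two_branches (hf : IsPathSeq G f n) (hG : NoSubharmonic G) {y y' : V}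
    (hy : ∀ a ≤ n, f a ≠ y) (hy' : ∀ a ≤ n, f a ≠ y') (hyy : y ≠ y') {i j : ℕ} (hi : 0 < i)
    (hij : i ≤ j) (hj : j < n) (hadj : G.Adj (f i) y) (hadj' : G.Adj (f j) y') : False := by
  obtain ⟨h, hh, h1, h2⟩ : ∃ h : ℕ → V, (∀ a ≤ n, h a = f a) ∧ h (n + 1) = y ∧ h (n + 2) = y' :=
    ⟨fun a => if a ≤ n then f a else if a = n + 1 then y else y', fun a ha => by simp [ha],
      by simp, by simp⟩
  have hp : ∀ a, 0 < a → a ≤ n → G.Adj (h a) (h (a - 1)) := fun a h0 ha => by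
    rw [hh a ha, hh (a - 1) (by omega)]; exact hf.adj_pred h0 ha
  have hs : ∀ a < n, G.Adj (h a) (h (a + 1)) := fun a ha => by
    rw [hh a ha.le, hh (a + 1) ha]; exact hf.adj a ha
  rw [← hh i (by omega), ← h1] at hadj
  rw [← hh j (by omega), ← h2] at hadj'
  refine hG.false_of_labels (h := h)
    (D := insert (n + 1) (insert (n + 2) (Finset.Icc (i - 1) (j + 1)))) ⟨n + 1, by simp⟩ ?_
    (fun a => if i ≤ a ∧ a ≤ j then 2 else 1) (by intro a _; split_ifs <;> omega) ?_
  · have hinj : ∀ a ≤ n + 2, ∀ b ≤ n + 2, a < b → h a ≠ h b := by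
      intro a ha b hb hab
      by_cases hbn : b ≤ n
      · rw [hh a (by omega), hh b hbn]
        exact fun h => hab.ne (hf.inj a (by omega) b hbn h)
      by_cases han : a ≤ n
      · rw [hh a han]
        rcases (show b = n + 1 ∨ b = n + 2 by omega) with rfl | rfl
        · rw [h1]; exact hy a han
        · rw [h2]; exact hy' a han
      · obtain rfl : a = n + 1 := by omega
        obtain rfl : b = n + 2 := by omega
        rwa [h1, h2]
    intro a ha b hb hab
    simp only [Finset.mem_insert, Finset.mem_Icc] at ha hb
    by_contra hne
    rcases lt_or_gt_of_ne hne with hlt | hlt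
    · exact hinj a (by omega) b (by omega) hlt hab
    · exact hinj b (by omega) a (by omega) hlt hab.symm
  · intro a ha
    simp only [Finset.mem_insert, Finset.mem_Icc] at ha
    by_cases ha1 : a = n + 1
    · subst ha1
      refine ⟨{i}, ?_, by simpa using hadj.symm, ?_⟩
      · simp; omega
      · simp; split_ifs <;> omega
    by_cases ha2 : a = n + 2
    · subst ha2
      refine ⟨{j}, ?_, by simpa using hadj'.symm, ?_⟩
      · simp; omega
      · simp; split_ifs <;> omega
    by_cases ha3 : a < i
    · refine ⟨{a + 1}, ?_, by simpa using hs a (by omega), ?_⟩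
      · simp; omega
      · simp; split_ifs <;> omega
    by_cases ha4 : j < a
    · refine ⟨{a - 1}, ?_, by simpa using hp a (by omega) (by omega), ?_⟩
      · simp; omega
      · simp; split_ifs <;> omega
    have hpa := hp a (by omega) (by omega)
    have hsa := hs a (by omega)
    by_cases ha5 : a = i
    · subst ha5
      by_cases haj : a = j
      · subst haj
        refine ⟨{a - 1, a + 1, n + 1, n + 2}, ?_, by simpa using ⟨hpa, hsa, hadj, hadj'⟩, ?_⟩
        · simp [Finset.insert_subset_iff]; omega
        · rw [Finset.sum_insert (by simp; omega), Finset.sum_insert (by simp; omega),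
            Finset.sum_pair (by omega)]
          split_ifs <;> omega
      · refine ⟨{a - 1, a + 1, n + 1}, ?_, by simpa using ⟨hpa, hsa, hadj⟩, ?_⟩
        · simp [Finset.insert_subset_iff]; omega
        · rw [Finset.sum_insert (by simp; omega), Finset.sum_pair (by omega)]
          split_ifs <;> omega
    by_cases ha6 : a = j
    · subst ha6
      refine ⟨{a - 1, a + 1, n + 2}, ?_, by simpa using ⟨hpa, hsa, hadj'⟩, ?_⟩
      · simp [Finset.insert_subset_iff]; omega
      · rw [Finset.sum_insert (by simp; omega), Finset.sum_pair (by omega)]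
        split_ifs <;> omega
    · refine ⟨{a - 1, a + 1}, ?_, by simpa using ⟨hpa, hsa⟩, ?_⟩
      · simp [Finset.insert_subset_iff]; omega
      · rw [Finset.sum_pair (by omega)]
        split_ifs <;> omega

/-- The legs of lengths `2, 2, 2` do not fit. -/
lemma not_long_branch (hf : IsPathSeq G f n) (hG : NoSubharmonic G) {y y' : V}
    (hy : ∀ a ≤ n, f a ≠ y) (hy' : ∀ a ≤ n, f a ≠ y') (hyy : y ≠ y') {i : ℕ} (hi : 2 ≤ i)
    (hn : i + 2 ≤ n) (hadj : G.Adj (f i) y) (hadj' : G.Adj y y') : False := by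
  obtain ⟨k, rfl⟩ : ∃ k, i = k + 2 := ⟨i - 2, by omega⟩
  obtain ⟨h, hh, h5, h6⟩ : ∃ h : ℕ → V, (∀ a ≤ 4, h a = f (k + a)) ∧ h 5 = y ∧ h 6 = y' :=
    ⟨fun a => if a ≤ 4 then f (k + a) else if a = 5 then y else y', fun a ha => by simp [ha],
      by simp, by simp⟩
  have hs : ∀ a < 4, G.Adj (h a) (h (a + 1)) := fun a ha => by
    rw [hh a ha.le, hh (a + 1) ha]; exact hf.adj (k + a) (by omega)
  rw [← hh 2 (by omega), ← h5] at hadj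
  rw [← h5, ← h6] at hadj'
  have a0 := hs 0 (by omega)
  have a1 := hs 1 (by omega)
  have a2 := hs 2 (by omega)
  have a3 := hs 3 (by omega)
  norm_num at a0 a1 a2 a3
  refine hG.false_of_labels (h := h) (D := Finset.range 7) ⟨0, by simp⟩ ?_
    (fun a => ![1, 2, 3, 2, 1, 2, 1] (Fin.ofNat 7 a)) ?_ ?_
  · have hinj : ∀ a ≤ 6, ∀ b ≤ 6, a < b → h a ≠ h b := by
      intro a ha b hb hab
      by_cases hbn : b ≤ 4
      · rw [hh a (by omega), hh b hbn]
        intro h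
        have := hf.inj _ (by omega) _ (by omega) h
        omega
      by_cases han : a ≤ 4
      · rw [hh a han]
        rcases (show b = 5 ∨ b = 6 by omega) with rfl | rfl
        · rw [h5]; exact hy _ (by omega)
        · rw [h6]; exact hy' _ (by omega)
      · obtain rfl : a = 5 := by omega
        obtain rfl : b = 6 := by omega
        rwa [h5, h6]
    intro a ha b hb hab
    rw [Finset.mem_range] at ha hb
    by_contra hne
    rcases lt_or_gt_of_ne hne with hlt | hlt
    · exact hinj a (by omega) b (by omega) hlt hab
    · exact hinj b (by omega) a (by omega) hlt hab.symm
  · intro a ha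
    rw [Finset.mem_range] at ha
    interval_cases a <;> decide
  · intro a ha
    rw [Finset.mem_range] at ha
    interval_cases a
    · exact ⟨{1}, by decide, by simpa using a0, by decide⟩
    · exact ⟨{0, 2}, by decide, by simpa using ⟨a0.symm, a1⟩, by decide⟩
    · exact ⟨{1, 3, 5}, by decide, by simpa using ⟨a1.symm, a2, hadj⟩, by decide⟩
    · exact ⟨{2, 4}, by decide, by simpa using ⟨a2.symm, a3⟩, by decide⟩
    · exact ⟨{3}, by decide, by simpa using a3.symm, by decide⟩
    · exact ⟨{2, 6}, by decide, by simpa using ⟨hadj.symm, hadj'⟩, by decide⟩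
    · exact ⟨{5}, by decide, by simpa using hadj'.symm, by decide⟩

lemma exists_longest (G : SimpleGraph V) [Finite V] [Nonempty V] :
    ∃ n f, IsPathSeq G f n ∧ ∀ m g, IsPathSeq G g m → m ≤ n := by
  classical
  have := Fintype.ofFinite V
  have hbound : ∀ m g, IsPathSeq G g m → m ≤ Fintype.card V := by
    intro m g hg
    have := Fintype.card_le_of_injective (fun a : Fin (m + 1) => g a)
      (fun a b hab => Fin.ext (hg.inj a (by omega) b (by omega) hab))
    rw [Fintype.card_fin] at this
    omega
  obtain ⟨v⟩ := ‹Nonempty V›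
  have h0 : ∃ f, IsPathSeq G f 0 :=
    ⟨fun _ => v, fun a ha b hb _ => by omega, fun a ha => by omega⟩
  obtain ⟨f, hf⟩ := Nat.findGreatest_spec (P := fun n => ∃ f, IsPathSeq G f n)
    (Nat.zero_le (Fintype.card V)) h0
  exact ⟨_, f, hf, fun m g hg => Nat.le_findGreatest (hbound m g hg) ⟨g, hg⟩⟩

/-- A branch of length two on a longest path is at distance at least two from the end. -/
lemma add_two_le_of_branch (hf : IsPathSeq G f n) (hmax : ∀ m g, IsPathSeq G g m → m ≤ n)
    {y y' : V} (hy : ∀ a ≤ n, f a ≠ y) (hy' : ∀ a ≤ n, f a ≠ y') (hyy : y ≠ y') {i : ℕ}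
    (hi : i ≤ n) (hadj : G.Adj (f i) y) (hadj' : G.Adj y y') : i + 2 ≤ n := by
  have h1 := (hf.mono hi).append (fun a ha => hy a (ha.trans hi)) hadj
  refine hmax _ _ (h1.append (y := y') (fun a ha => ?_) (by simpa using hadj'))
  split_ifs with h
  · exact hy' a (h.trans hi)
  · exact hyy

end IsPathSeq

/-- A finite connected graph without subharmonic functions is a path, or a path with one extra
vertex attached next to its end, or attached at position `2` of a path with 5, 6 or 7 vertices. -/
theorem NoSubharmonic.exists_path_or_branch [Finite V] [Nonempty V] (hG : NoSubharmonic G)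
    (hconn : ∀ S : Set V, S.Nonempty → (∀ a ∈ S, ∀ b, G.Adj a b → b ∈ S) → S = Set.univ) :
    ∃ n h, (IsPathSeq G h n ∧ ∀ v, ∃ a ≤ n, h a = v) ∨
      ∃ i, IsBranchSeq G h n i ∧ (∀ v, ∃ a ≤ n + 1, h a = v) ∧
        ((2 ≤ n ∧ i + 1 = n) ∨ (i = 2 ∧ 4 ≤ n ∧ n ≤ 6)) := by
  obtain ⟨n, f, hf, hmax⟩ := IsPathSeq.exists_longest G
  by_cases hsurj : ∀ v, ∃ a ≤ n, f a = v
  · exact ⟨n, f, Or.inl ⟨hf, hsurj⟩⟩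
  have hlast : ∀ {g y}, IsPathSeq G g n → (∀ a ≤ n, g a ≠ y) → ¬ G.Adj (g n) y :=
    fun hg hy hadj => absurd (hmax _ _ (hg.append hy hadj)) (by omega)
  have hinterior : ∀ {i y}, i ≤ n → (∀ a ≤ n, f a ≠ y) → G.Adj (f i) y → 0 < i ∧ i < n := by
    intro i y hi hy hadj
    have h1 : i ≠ n := by
      rintro rfl
      exact hlast hf hy hadj
    have h2 : i ≠ 0 := by
      rintro rfl
      exact hlast hf.reverse (fun a ha => hy _ (by omega)) (by simpa using hadj)
    omega
  obtain ⟨i, y, hi, hy, hadj⟩ : ∃ i y, i ≤ n ∧ (∀ a ≤ n, f a ≠ y) ∧ G.Adj (f i) y := by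
    by_contra! hcon
    refine hsurj fun v => ?_
    have := hconn {v | ∃ a ≤ n, f a = v} ⟨f 0, 0, by omega, rfl⟩ ?_
    · exact Set.eq_univ_iff_forall.1 this v
    · rintro _ ⟨a, ha, rfl⟩ b hab
      by_contra hb
      exact hcon a b ha (fun c hc hcb => hb ⟨c, hc, hcb⟩) hab
  have hall : ∀ v, v = y ∨ ∃ a ≤ n, f a = v := by
    intro v
    have := hconn {v | v = y ∨ ∃ a ≤ n, f a = v} ⟨y, Or.inl rfl⟩ ?_
    · exact Set.eq_univ_iff_forall.1 this v
    intro w hw y' hwy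
    by_contra hnot
    obtain ⟨hyy, hy'⟩ : y' ≠ y ∧ ∀ a ≤ n, f a ≠ y' :=
      ⟨fun h => hnot (Or.inl h), fun a ha h => hnot (Or.inr ⟨a, ha, h⟩)⟩
    rcases hw with rfl | ⟨j, hj, rfl⟩
    · have hle := hf.add_two_le_of_branch hmax hy hy' (Ne.symm hyy) hi hadj hwy
      have hge := hf.reverse.add_two_le_of_branch hmax (y := w) (y' := y')
        (fun a ha => hy _ (by omega)) (fun a ha => hy' _ (by omega)) (Ne.symm hyy)
        (Nat.sub_le n i) (by simpa [Nat.sub_sub_self hi] using hadj) hwy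
      exact hf.not_long_branch hG hy hy' (Ne.symm hyy) (by omega) hle hadj hwy
    · obtain ⟨hi0, hin⟩ := hinterior hi hy hadj
      obtain ⟨hj0, hjn⟩ := hinterior hj hy' hwy
      rcases le_total i j with hij | hij
      · exact hf.not_two_branches hG hy hy' (Ne.symm hyy) hi0 hij hjn hadj hwy
      · exact hf.not_two_branches hG hy' hy hyy hj0 hij hin hwy hadj
  obtain ⟨hi0, hin⟩ := hinterior hi hy hadj
  have hb : IsBranchSeq G (fun a => if a ≤ n then f a else y) n i := by
    refine ⟨⟨fun a ha b hb hab => ?_, fun a ha => ?_⟩, fun a ha => ?_, ?_, hi⟩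
    · simp only [if_pos ha, if_pos hb] at hab
      exact hf.inj a ha b hb hab
    · simp only [if_pos ha.le, if_pos (show a + 1 ≤ n from ha)]
      exact hf.adj a ha
    · simpa [ha] using hy a ha
    · simpa [hi] using hadj
  have hbs : ∀ v, ∃ a ≤ n + 1, (if a ≤ n then f a else y) = v := by
    intro v
    rcases hall v with rfl | ⟨a, ha, rfl⟩
    · exact ⟨n + 1, le_rfl, by simp⟩
    · exact ⟨a, by omega, by simp [ha]⟩
  obtain ⟨h, hb, hbs⟩ : ∃ h : ℕ → V, IsBranchSeq G h n i ∧ ∀ v, ∃ a ≤ n + 1, h a = v :=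
    ⟨_, hb, hbs⟩
  have hcases : ∀ {h : ℕ → V} {i : ℕ}, IsBranchSeq G h n i → (∀ v, ∃ a ≤ n + 1, h a = v) →
      0 < i → i < n → (i + 1 = n ∨ i = 2) →
      ∃ n h, (IsPathSeq G h n ∧ ∀ v, ∃ a ≤ n, h a = v) ∨
      ∃ i, IsBranchSeq G h n i ∧ (∀ v, ∃ a ≤ n + 1, h a = v) ∧
        ((2 ≤ n ∧ i + 1 = n) ∨ (i = 2 ∧ 4 ≤ n ∧ n ≤ 6)) := by
    intro h i hb hbs hi0 hin hi
    refine ⟨n, h, Or.inr ⟨i, hb, hbs, ?_⟩⟩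
    by_cases hin' : i + 1 = n
    · exact Or.inl ⟨by omega, hin'⟩
    · obtain rfl : i = 2 := by omega
      have := hb.lt_seven hG
      exact Or.inr ⟨rfl, by omega, by omega⟩
  have hbs' : ∀ v, ∃ a ≤ n + 1, (if a ≤ n then h (n - a) else h (n + 1)) = v := by
    intro v
    obtain ⟨a, ha, rfl⟩ := hbs v
    by_cases han : a ≤ n
    · exact ⟨n - a, by omega, by simp [Nat.sub_sub_self han]⟩
    · exact ⟨n + 1, le_rfl, by rw [if_neg (by omega), show a = n + 1 by omega]⟩
  by_cases h1 : i + 1 = n ∨ i = 2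
  · exact hcases hb hbs hi0 hin h1
  by_cases h2 : n - i + 1 = n ∨ n - i = 2
  · exact hcases hb.reverse hbs' (by omega) (by omega) h2
  · exact (hb.not_three_le hG (by omega) (by omega)).elim

end Graph

section Bipartite

variable {α β : Type*} {X : Matrix α β ℝ}

/-- The bipartite graph on rows and columns of `X` given by the nonzero entries. -/
def bipGraph (X : Matrix α β ℝ) : SimpleGraph (α ⊕ β) where
  Adj u v := (∃ i j, u = Sum.inl i ∧ v = Sum.inr j ∧ X i j ≠ 0) ∨
    ∃ i j, v = Sum.inl i ∧ u = Sum.inr j ∧ X i j ≠ 0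
  symm := ⟨fun _ _ h => h.symm⟩
  loopless := ⟨by rintro u (⟨i, j, rfl, h, -⟩ | ⟨i, j, rfl, h, -⟩) <;> simp at h⟩

lemma bipGraph_adj_inl_inr {i : α} {j : β} :
    (bipGraph X).Adj (Sum.inl i) (Sum.inr j) ↔ X i j ≠ 0 := by
  simp [bipGraph]

lemma bipGraph_adj_inl {i : α} {v : α ⊕ β} :
    (bipGraph X).Adj (Sum.inl i) v ↔ ∃ j, v = Sum.inr j ∧ X i j ≠ 0 := by
  simp [bipGraph]

lemma bipGraph_adj_inr {j : β} {v : α ⊕ β} :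
    (bipGraph X).Adj (Sum.inr j) v ↔ ∃ i, v = Sum.inl i ∧ X i j ≠ 0 := by
  simp [bipGraph]

lemma isLeft_of_bipGraph_adj {u v : α ⊕ β} (h : (bipGraph X).Adj u v) :
    v.isLeft = !u.isLeft := by
  rcases h with ⟨i, j, rfl, rfl, -⟩ | ⟨i, j, rfl, rfl, -⟩ <;> rfl

lemma IsPathSeq.isLeft_eq {f : ℕ → α ⊕ β} {n : ℕ} (hf : IsPathSeq (bipGraph X) f n) :
    ∀ k ≤ n, (f k).isLeft = if k % 2 = 0 then (f 0).isLeft else !(f 0).isLeft := by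
  intro k
  induction k with
  | zero => simp
  | succ k ih =>
    intro hk
    rw [isLeft_of_bipGraph_adj (hf.adj k hk), ih (by omega)]
    rcases Nat.mod_two_eq_zero_or_one k with h | h
    · simp [h, show (k + 1) % 2 = 1 by omega]
    · simp [h, show (k + 1) % 2 = 0 by omega]

variable [Fintype α] [Fintype β]

lemma dotProduct_mulVec_lt [DecidableEq α]
    (h : ∀ μ : ℝ, ∀ v : α → ℝ, v ≠ 0 → (X * Xᵀ).mulVec v = μ • v → μ < 4) {u : α → ℝ} {w : β → ℝ}
    (hne : u ≠ 0 ∨ w ≠ 0) : u ⬝ᵥ X *ᵥ w < u ⬝ᵥ u + w ⬝ᵥ w := by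
  have hH : ((4 : ℝ) • (1 : Matrix α α ℝ) - X * Xᵀ).IsHermitian := by
    rw [Matrix.IsHermitian, Matrix.conjTranspose_eq_transpose_of_trivial]
    simp [Matrix.transpose_sub, Matrix.transpose_mul]
  have hP : ((4 : ℝ) • (1 : Matrix α α ℝ) - X * Xᵀ).PosDef := by
    rw [hH.posDef_iff_eigenvalues_pos]
    intro i
    have hv := hH.mulVec_eigenvectorBasis i
    set v : α → ℝ := ⇑(hH.eigenvectorBasis i) with hvdef
    have hv0 : v ≠ 0 := by
      intro h0
      apply (hH.eigenvectorBasis.orthonormal.ne_zero i)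
      ext a
      exact congrFun h0 a
    have := h (4 - hH.eigenvalues i) v hv0 ?_
    · linarith
    · rw [Matrix.sub_mulVec, Matrix.smul_mulVec, Matrix.one_mulVec] at hv
      rw [sub_smul, ← hv]
      abel
  have ht : u ⬝ᵥ X *ᵥ w = (Xᵀ *ᵥ u) ⬝ᵥ w := by
    rw [Matrix.dotProduct_mulVec, Matrix.mulVec_transpose]
  have htt : u ⬝ᵥ ((4 : ℝ) • (1 : Matrix α α ℝ) - X * Xᵀ) *ᵥ u
      = 4 * (u ⬝ᵥ u) - (Xᵀ *ᵥ u) ⬝ᵥ (Xᵀ *ᵥ u) := by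
    rw [Matrix.sub_mulVec, Matrix.smul_mulVec, Matrix.one_mulVec, dotProduct_sub,
      dotProduct_smul, ← Matrix.mulVec_mulVec, Matrix.dotProduct_mulVec u X, Matrix.mulVec_transpose,
      smul_eq_mul]
  have hsq : 0 ≤ (w - (1 / 2 : ℝ) • (Xᵀ *ᵥ u)) ⬝ᵥ (w - (1 / 2 : ℝ) • (Xᵀ *ᵥ u)) :=
    Finset.sum_nonneg fun i _ => mul_self_nonneg _
  simp only [sub_dotProduct, dotProduct_sub, smul_dotProduct, dotProduct_smul, smul_eq_mul] at hsq
  rw [dotProduct_comm w (Xᵀ *ᵥ u)] at hsq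
  rw [ht]
  by_cases hu : u = 0
  · subst hu
    have hw : w ≠ 0 := hne.resolve_left (by simp)
    have : 0 < w ⬝ᵥ w := by
      have := Matrix.dotProduct_star_self_pos_iff.2 hw
      simpa using this
    simpa using this
  · have := hP.dotProduct_mulVec_pos hu
    rw [star_trivial, htt] at this
    linarith

lemma noSubharmonic_bipGraph [DecidableEq α] (hnat : ∀ i j, ∃ n : ℕ, X i j = (n : ℝ))
    (h : ∀ μ : ℝ, ∀ v : α → ℝ, v ≠ 0 → (X * Xᵀ).mulVec v = μ • v → μ < 4) :
    NoSubharmonic (bipGraph X) := by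
  classical
  intro z hz
  by_contra! hcon
  have hone : ∀ i j, X i j ≠ 0 → 1 ≤ X i j := by
    intro i j hij
    obtain ⟨n, hn⟩ := hnat i j
    rw [hn] at hij ⊢
    exact_mod_cast Nat.one_le_iff_ne_zero.2 (by exact_mod_cast hij)
  have hnn : ∀ i j, 0 ≤ X i j := fun i j => by
    obtain ⟨n, hn⟩ := hnat i j
    rw [hn]; positivity
  have hle : ∀ i j (c : ℝ), 0 ≤ c → (if X i j ≠ 0 then c else 0) ≤ X i j * c := by
    intro i j c hc
    split_ifs with h0
    · exact le_mul_of_one_le_left hc (hone i j h0)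
    · exact mul_nonneg (hnn i j) hc
  let u : α → ℝ := fun i => z (Sum.inl i)
  let w : β → ℝ := fun j => z (Sum.inr j)
  have hrow : ∀ i, 2 * (u i * u i) ≤ u i * (X *ᵥ w) i := by
    intro i
    by_cases hi : z (Sum.inl i) = 0
    · simp [u, hi]
    obtain ⟨S, hS, hsum⟩ := hcon _ hi
    have h1 : S ⊆ (Finset.univ.filter fun j => X i j ≠ 0).image Sum.inr := by
      intro v hv
      obtain ⟨j, rfl, hj⟩ := bipGraph_adj_inl.1 (hS v hv)
      simpa using hj
    have h2 := hsum.trans (Finset.sum_le_sum_of_subset h1)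
    rw [Finset.sum_image (fun _ _ _ _ h => Sum.inr_injective h)] at h2
    have h3 : 2 * u i ≤ ∑ j with X i j ≠ 0, w j := by
      simp only [u, w]; exact_mod_cast h2
    have h4 : 2 * u i ≤ (X *ᵥ w) i := by
      refine h3.trans ?_
      rw [Finset.sum_filter]
      exact Finset.sum_le_sum fun j _ => hle i j _ (Nat.cast_nonneg _)
    have := mul_le_mul_of_nonneg_left h4 (show 0 ≤ u i from Nat.cast_nonneg _)
    linarith
  have hcol : ∀ j, 2 * (w j * w j) ≤ (u ᵥ* X) j * w j := by
    intro j
    by_cases hj : z (Sum.inr j) = 0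
    · simp [w, hj]
    obtain ⟨S, hS, hsum⟩ := hcon _ hj
    have h1 : S ⊆ (Finset.univ.filter fun i => X i j ≠ 0).image Sum.inl := by
      intro v hv
      obtain ⟨i, rfl, hi⟩ := bipGraph_adj_inr.1 (hS v hv)
      simpa using hi
    have h2 := hsum.trans (Finset.sum_le_sum_of_subset h1)
    rw [Finset.sum_image (fun _ _ _ _ h => Sum.inl_injective h)] at h2
    have h3 : 2 * w j ≤ ∑ i with X i j ≠ 0, u i := by
      simp only [u, w]; exact_mod_cast h2
    have h4 : 2 * w j ≤ (u ᵥ* X) j := by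
      refine h3.trans ?_
      rw [Finset.sum_filter]
      refine Finset.sum_le_sum fun i _ => ?_
      rw [mul_comm]
      exact hle i j _ (Nat.cast_nonneg _)
    have := mul_le_mul_of_nonneg_left h4 (show 0 ≤ w j from Nat.cast_nonneg _)
    linarith
  have hlt : u ⬝ᵥ X *ᵥ w < u ⬝ᵥ u + w ⬝ᵥ w := by
    refine dotProduct_mulVec_lt h ?_
    obtain ⟨i | j, hv⟩ := hz
    · exact Or.inl fun h0 => hv (by simpa [u] using congrFun h0 i)
    · exact Or.inr fun h0 => hv (by simpa [w] using congrFun h0 j)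
  have hR : 2 * (u ⬝ᵥ u) ≤ u ⬝ᵥ X *ᵥ w := by
    simp only [dotProduct, Finset.mul_sum]
    exact Finset.sum_le_sum fun i _ => hrow i
  have hC : 2 * (w ⬝ᵥ w) ≤ u ⬝ᵥ X *ᵥ w := by
    rw [Matrix.dotProduct_mulVec]
    simp only [dotProduct, Finset.mul_sum]
    exact Finset.sum_le_sum fun j _ => hcol j
  linarith

lemma eq_one_of_ne_zero [DecidableEq α] (hnat : ∀ i j, ∃ n : ℕ, X i j = (n : ℝ))
    (h : ∀ μ : ℝ, ∀ v : α → ℝ, v ≠ 0 → (X * Xᵀ).mulVec v = μ • v → μ < 4) {i : α} {j : β}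
    (hij : X i j ≠ 0) : X i j = 1 := by
  classical
  have hlt := dotProduct_mulVec_lt h (u := Pi.single i 1) (w := Pi.single j 1) (Or.inl (by simp))
  simp at hlt
  obtain ⟨n, hn⟩ := hnat i j
  rw [hn] at hlt hij ⊢
  have h2 : n < 2 := by
    have : (n : ℝ) < 2 := by linarith
    exact_mod_cast this
  have h0 : n ≠ 0 := by exact_mod_cast hij
  exact_mod_cast (show n = 1 by omega)

end Bipartite

/-- Matrix powers cannot leave a set of indices closed under the nonzero entries. -/
lemma mem_of_pow_ne_zero {α : Type*} [Fintype α] [DecidableEq α] {M : Matrix α α ℝ} {S : Set α}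
    (hS : ∀ i ∈ S, ∀ k, M i k ≠ 0 → k ∈ S) {i : α} (hi : i ∈ S) (m : ℕ) :
    ∀ k, (M ^ m) i k ≠ 0 → k ∈ S := by
  induction m with
  | zero =>
    intro k hk
    rw [pow_zero, Matrix.one_apply] at hk
    obtain rfl : i = k := by
      by_contra hne
      exact hk (if_neg hne)
    exact hi
  | succ m ih =>
    intro k hk
    rw [pow_succ, Matrix.mul_apply] at hk
    obtain ⟨l, -, hl⟩ := Finset.exists_ne_zero_of_sum_ne_zero hk
    exact hS l (ih l (left_ne_zero_of_mul hl)) k (right_ne_zero_of_mul hl)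

lemma bipGraph_closed_eq_univ {p q : ℕ} {X : Matrix (Fin p) (Fin q) ℝ}
    (h1 : IsIrreducibleMat (X * Xᵀ)) (h2 : IsIrreducibleMat (Xᵀ * X)) (S : Set (Fin p ⊕ Fin q))
    (hS : S.Nonempty) (hcl : ∀ a ∈ S, ∀ b, (bipGraph X).Adj a b → b ∈ S) : S = Set.univ := by
  have hcol : ∀ j, ∃ i, X i j ≠ 0 := by
    intro j
    obtain ⟨m, hm, hpos⟩ := h2 j j
    obtain ⟨m, rfl⟩ : ∃ l, m = l + 1 := ⟨m - 1, by omega⟩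
    rw [pow_succ', Matrix.mul_apply] at hpos
    obtain ⟨l, -, hl⟩ := Finset.exists_ne_zero_of_sum_ne_zero hpos.ne'
    have hl := left_ne_zero_of_mul hl
    rw [Matrix.mul_apply] at hl
    obtain ⟨i, -, hi⟩ := Finset.exists_ne_zero_of_sum_ne_zero hl
    exact ⟨i, left_ne_zero_of_mul hi⟩
  have hrow : ∃ i, Sum.inl i ∈ S := by
    obtain ⟨i | j, hv⟩ := hS
    · exact ⟨i, hv⟩
    · obtain ⟨i, hi⟩ := hcol j
      exact ⟨i, hcl _ hv _ (bipGraph_adj_inl_inr.2 hi).symm⟩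
  obtain ⟨i, hi⟩ := hrow
  have hleft : ∀ k, Sum.inl k ∈ S := by
    intro k
    obtain ⟨m, -, hpos⟩ := h1 i k
    refine mem_of_pow_ne_zero (S := {k | Sum.inl k ∈ S}) ?_ hi m k hpos.ne'
    intro a ha b hab
    rw [Matrix.mul_apply] at hab
    obtain ⟨j, -, hj⟩ := Finset.exists_ne_zero_of_sum_ne_zero hab
    have hj1 := hcl _ ha _ (bipGraph_adj_inl_inr.2 (left_ne_zero_of_mul hj))
    exact hcl _ hj1 _ (bipGraph_adj_inl_inr (X := X).2 (right_ne_zero_of_mul hj)).symm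
  refine Set.eq_univ_iff_forall.2 ?_
  rintro (k | j)
  · exact hleft k
  · obtain ⟨k, hk⟩ := hcol j
    exact hcl _ (hleft k) _ (bipGraph_adj_inl_inr.2 hk)

section Labels

variable {p q : ℕ} {X : Matrix (Fin p) (Fin q) ℝ}

open Classical in
/-- A bijective labelling of the vertices of `bipGraph X` by numbers less than `N`, together with
enumerations `a` and `b` of the labels in the two colour classes, identifies `X` up to
permutations and transposition. -/
lemma permEquiv_of_labels (h01 : ∀ i j, X i j ≠ 0 → X i j = 1) {N : ℕ} {h : ℕ → Fin p ⊕ Fin q}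
    (hinj : ∀ a < N, ∀ b < N, h a = h b → a = b) (hsurj : ∀ v, ∃ a < N, h a = v) {r s : ℕ}
    (Y : Matrix (Fin r) (Fin s) ℝ) (a : Fin r → ℕ) (b : Fin s → ℕ) (t : Bool)
    (ha : ∀ i, a i < N) (hb : ∀ j, b j < N) (hat : ∀ i, (h (a i)).isLeft = t)
    (hbt : ∀ j, (h (b j)).isLeft = !t) (hai : Function.Injective a) (hbi : Function.Injective b)
    (hcover : ∀ k < N, (∃ i, a i = k) ∨ ∃ j, b j = k)
    (hY : ∀ i j, Y i j = if (bipGraph X).Adj (h (a i)) (h (b j)) then 1 else 0) :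
    PermEquiv X Y ∨ PermEquiv X Yᵀ := by
  have hX : ∀ i j, X i j = if X i j ≠ 0 then 1 else 0 := by
    intro i j
    split_ifs with h0
    · exact h01 i j h0
    · exact not_not.1 h0
  have hA : ∀ v, v.isLeft = t → ∃ i, h (a i) = v := by
    intro v hv
    obtain ⟨k, hk, rfl⟩ := hsurj v
    rcases hcover k hk with ⟨i, rfl⟩ | ⟨j, rfl⟩
    · exact ⟨i, rfl⟩
    · rw [hbt j] at hv
      simp at hv
  have hB : ∀ v, v.isLeft = (!t) → ∃ j, h (b j) = v := by
    intro v hv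
    obtain ⟨k, hk, rfl⟩ := hsurj v
    rcases hcover k hk with ⟨i, rfl⟩ | ⟨j, rfl⟩
    · rw [hat i] at hv
      simp at hv
    · exact ⟨j, rfl⟩
  have hha : ∀ i i', h (a i) = h (a i') → i = i' := fun i i' e => hai (hinj _ (ha i) _ (ha i') e)
  have hhb : ∀ j j', h (b j) = h (b j') → j = j' := fun j j' e => hbi (hinj _ (hb j) _ (hb j') e)
  cases t with
  | true =>
    left
    choose R hR using fun x : Fin p => hA (Sum.inl x) rfl
    choose C hC using fun y : Fin q => hB (Sum.inr y) rfl
    have hRb : Function.Bijective R := by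
      refine ⟨fun x x' e => Sum.inl_injective (by rw [← hR x, ← hR x', e]), fun i => ?_⟩
      obtain ⟨x, hx⟩ := Sum.isLeft_iff.1 (hat i)
      exact ⟨x, hha _ _ (by rw [hR, hx])⟩
    have hCb : Function.Bijective C := by
      refine ⟨fun x x' e => Sum.inr_injective (by rw [← hC x, ← hC x', e]), fun j => ?_⟩
      obtain ⟨x, hx⟩ := Sum.isRight_iff.1 (Sum.isLeft_eq_false.1 (hbt j))
      exact ⟨x, hhb _ _ (by rw [hC, hx])⟩
    refine ⟨Equiv.ofBijective R hRb, Equiv.ofBijective C hCb, fun x y => ?_⟩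
    rw [Equiv.ofBijective_apply, Equiv.ofBijective_apply, hY, hR, hC, hX]
    simp only [bipGraph_adj_inl_inr]
  | false =>
    right
    choose R hR using fun x : Fin p => hB (Sum.inl x) rfl
    choose C hC using fun y : Fin q => hA (Sum.inr y) rfl
    have hRb : Function.Bijective R := by
      refine ⟨fun x x' e => Sum.inl_injective (by rw [← hR x, ← hR x', e]), fun i => ?_⟩
      obtain ⟨x, hx⟩ := Sum.isLeft_iff.1 (hbt i)
      exact ⟨x, hhb _ _ (by rw [hR, hx])⟩
    have hCb : Function.Bijective C := by
      refine ⟨fun x x' e => Sum.inr_injective (by rw [← hC x, ← hC x', e]), fun j => ?_⟩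
      obtain ⟨x, hx⟩ := Sum.isRight_iff.1 (Sum.isLeft_eq_false.1 (hat j))
      exact ⟨x, hha _ _ (by rw [hC, hx])⟩
    refine ⟨Equiv.ofBijective R hRb, Equiv.ofBijective C hCb, fun x y => ?_⟩
    rw [Equiv.ofBijective_apply, Equiv.ofBijective_apply, Matrix.transpose_apply, hY, hR, hC, hX,
      SimpleGraph.adj_comm]
    simp only [bipGraph_adj_inl_inr]

lemma IsPathSeq.isStaircase (h01 : ∀ i j, X i j ≠ 0 → X i j = 1)
    (hG : NoSubharmonic (bipGraph X)) {f : ℕ → Fin p ⊕ Fin q} {n : ℕ} (hn : 1 ≤ n)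
    (hf : IsPathSeq (bipGraph X) f n) (hsurj : ∀ v, ∃ a ≤ n, f a = v) : IsStaircase X := by
  classical
  have hcol := hf.isLeft_eq
  have hinj : ∀ a < n + 1, ∀ b < n + 1, f a = f b → a = b :=
    fun a ha b hb => hf.inj a (by omega) b (by omega)
  have hsurj' : ∀ v, ∃ a < n + 1, f a = v := fun v => by
    obtain ⟨a, ha, h⟩ := hsurj v
    exact ⟨a, by omega, h⟩
  obtain ⟨k, rfl | rfl⟩ := Nat.even_or_odd' n
  · refine ⟨k, by omega, ?_⟩
    have := permEquiv_of_labels h01 hinj hsurj' (stairRect k) (fun i => 2 * i + 1) (fun j => 2 * j)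
      (!(f 0).isLeft) (fun i => by omega) (fun j => by omega)
      (fun i => by rw [hcol _ (by omega), if_neg (by omega)])
      (fun j => by rw [hcol _ (by omega), if_pos (by omega), Bool.not_not])
      (fun i i' h => by dsimp only at h; omega) (fun i i' h => by dsimp only at h; omega) ?_ ?_
    · tauto
    · intro m hm
      obtain ⟨l, rfl | rfl⟩ := Nat.even_or_odd' m
      · exact Or.inr ⟨⟨l, by omega⟩, rfl⟩
      · exact Or.inl ⟨⟨l, by omega⟩, rfl⟩
    · intro i j
      rw [stairRect, Matrix.of_apply]
      refine if_congr ?_ rfl rfl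
      rw [hf.adj_iff hG (by omega) (by omega)]
      omega
  · refine ⟨k + 1, by omega, ?_⟩
    have := permEquiv_of_labels h01 hinj hsurj' (stairSq (k + 1))ᵀ (fun i => 2 * i)
      (fun j => 2 * j + 1) (f 0).isLeft (fun i => by omega) (fun j => by omega)
      (fun i => by rw [hcol _ (by omega), if_pos (by omega)])
      (fun j => by rw [hcol _ (by omega), if_neg (by omega)])
      (fun i i' h => by dsimp only at h; omega) (fun i i' h => by dsimp only at h; omega) ?_ ?_
    · rw [Matrix.transpose_transpose] at this
      tauto
    · intro m hm
      obtain ⟨l, rfl | rfl⟩ := Nat.even_or_odd' m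
      · exact Or.inl ⟨⟨l, by omega⟩, rfl⟩
      · exact Or.inr ⟨⟨l, by omega⟩, rfl⟩
    · intro i j
      rw [stairSq, Matrix.transpose_apply, Matrix.of_apply]
      refine if_congr ?_ rfl rfl
      rw [hf.adj_iff hG (by omega) (by omega)]
      omega

namespace IsBranchSeq

variable {h : ℕ → Fin p ⊕ Fin q} {n i : ℕ}

lemma isLeft_eq (hb : IsBranchSeq (bipGraph X) h n i) {k : ℕ} (hk : k ≤ n + 1) :
    (h k).isLeft = if (if k ≤ n then k else i + 1) % 2 = 0 then (h 0).isLeft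
      else !(h 0).isLeft := by
  by_cases hkn : k ≤ n
  · rw [if_pos hkn, hb.path.isLeft_eq k hkn]
  · obtain rfl : k = n + 1 := by omega
    rw [if_neg hkn, isLeft_of_bipGraph_adj hb.adj, hb.path.isLeft_eq i hb.le]
    rcases Nat.mod_two_eq_zero_or_one i with h | h
    · simp [h, show (i + 1) % 2 = 1 by omega]
    · simp [h, show (i + 1) % 2 = 0 by omega]

lemma isExtStaircase (h01 : ∀ i j, X i j ≠ 0 → X i j = 1) (hG : NoSubharmonic (bipGraph X))
    (hb : IsBranchSeq (bipGraph X) h n i) (hsurj : ∀ v, ∃ a ≤ n + 1, h a = v) (hn : 2 ≤ n)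
    (hi : i + 1 = n) : IsExtStaircase X := by
  classical
  have hinj : ∀ a < n + 2, ∀ b < n + 2, h a = h b → a = b :=
    fun a ha b hb' => hb.inj a (by omega) b (by omega)
  have hsurj' : ∀ v, ∃ a < n + 2, h a = v := fun v => by
    obtain ⟨a, ha, h⟩ := hsurj v
    exact ⟨a, by omega, h⟩
  obtain ⟨k, rfl | rfl⟩ := Nat.even_or_odd' n
  · refine ⟨k, by omega, ?_⟩
    have := permEquiv_of_labels h01 hinj hsurj' (extB k) (fun i => 2 * i + 1)
      (fun j => min (2 * j) (2 * k + 1))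
      (!(h 0).isLeft) (fun i => by omega) (fun j => by omega)
      (fun j => by rw [hb.isLeft_eq (by omega), if_neg (by split_ifs <;> omega)])
      (fun j => by rw [hb.isLeft_eq (by omega), if_pos (by split_ifs <;> omega), Bool.not_not])
      (fun i i' h => by dsimp only at h; omega) (fun i i' h => by dsimp only at h; omega) ?_ ?_
    · tauto
    · intro m hm
      by_cases hmk : m = 2 * k + 1
      · exact Or.inr ⟨⟨k + 1, by omega⟩, by dsimp only; omega⟩
      obtain ⟨l, rfl | rfl⟩ := Nat.even_or_odd' m
      · exact Or.inr ⟨⟨l, by omega⟩, by dsimp only; omega⟩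
      · exact Or.inl ⟨⟨l, by omega⟩, rfl⟩
    · intro i j
      rw [extB, Matrix.of_apply]
      refine if_congr ?_ rfl rfl
      rw [hb.adj_iff_of_le hG (by omega) (by omega)]
      omega
  · refine ⟨k + 1, by omega, ?_⟩
    have := permEquiv_of_labels h01 hinj hsurj' (extA (k + 1))
      (fun j => min (2 * j + 1) (2 * k + 2)) (fun i => 2 * i)
      (!(h 0).isLeft) (fun i => by omega) (fun j => by omega)
      (fun j => by rw [hb.isLeft_eq (by omega), if_neg (by split_ifs <;> omega)])
      (fun j => by rw [hb.isLeft_eq (by omega), if_pos (by split_ifs <;> omega), Bool.not_not])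
      (fun i i' h => by dsimp only at h; omega) (fun i i' h => by dsimp only at h; omega) ?_ ?_
    · tauto
    · intro m hm
      by_cases hmk : m = 2 * k + 2
      · exact Or.inl ⟨⟨k + 1, by omega⟩, by dsimp only; omega⟩
      obtain ⟨l, rfl | rfl⟩ := Nat.even_or_odd' m
      · exact Or.inr ⟨⟨l, by omega⟩, rfl⟩
      · exact Or.inl ⟨⟨l, by omega⟩, by dsimp only; omega⟩
    · intro i j
      rw [extA, Matrix.of_apply]
      refine if_congr ?_ rfl rfl
      rw [hb.adj_iff_of_le hG (by omega) (by omega)]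
      omega

lemma permEquiv_of_two (h01 : ∀ i j, X i j ≠ 0 → X i j = 1) (hG : NoSubharmonic (bipGraph X))
    (hb : IsBranchSeq (bipGraph X) h n 2) (hsurj : ∀ v, ∃ a ≤ n + 1, h a = v) {r s : ℕ}
    (Y : Matrix (Fin r) (Fin s) ℝ) (a : Fin r → ℕ) (b : Fin s → ℕ)
    (ha : ∀ i, a i ≤ n ∧ a i % 2 = 0) (hbc : ∀ j, (b j ≤ n ∧ b j % 2 = 1) ∨ b j = n + 1)
    (hai : Function.Injective a) (hbi : Function.Injective b)
    (hcover : ∀ k < n + 2, (∃ i, a i = k) ∨ ∃ j, b j = k)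
    (hY : ∀ i j, Y i j = if (a i + 1 = b j ∧ b j ≤ n) ∨ b j + 1 = a i ∨ (a i = 2 ∧ b j = n + 1)
      then 1 else 0) :
    PermEquiv X Y ∨ PermEquiv X Yᵀ := by
  classical
  have hinj : ∀ a < n + 2, ∀ b < n + 2, h a = h b → a = b :=
    fun a ha b hb' => hb.inj a (by omega) b (by omega)
  have hsurj' : ∀ v, ∃ a < n + 2, h a = v := fun v => by
    obtain ⟨a, ha, h⟩ := hsurj v
    exact ⟨a, by omega, h⟩
  refine permEquiv_of_labels h01 hinj hsurj' Y a b (h 0).isLeft (fun i => ?_) (fun j => ?_)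
    (fun i => ?_) (fun j => ?_) hai hbi hcover fun i j => ?_
  · have := ha i
    omega
  · have := hbc j
    omega
  · have := ha i
    rw [hb.isLeft_eq (by omega), if_pos (by split_ifs <;> omega)]
  · have := hbc j
    rw [hb.isLeft_eq (by omega), if_neg]
    rcases this with hj | hj
    · rw [if_pos hj.1]
      omega
    · rw [if_neg (by omega)]
      norm_num
  · rw [hY]
    refine if_congr ?_ rfl rfl
    have h1 := ha i
    have h2 := hbc j
    rw [hb.adj_iff_of_le hG (by omega) (by omega)]
    omega

end IsBranchSeq

end Labels

/-- a nonzero matrix with nonnegative integer entries, such that `X·Xᵀ` and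
`Xᵀ·X` are irreducible and all eigenvalues of `X·Xᵀ` are `< 4`, can be reduced by
independent permutations of rows and columns to a staircase matrix, an extended staircase
matrix, one of `X₁`, `X₂`, `X₃`, or a transpose of one of these. -/
theorem statement0 {p q : ℕ} (X : Matrix (Fin p) (Fin q) ℝ)
    (hnat : ∀ i j, ∃ n : ℕ, X i j = (n : ℝ))
    (hX : X ≠ 0)
    (h1 : IsIrreducibleMat (X * Xᵀ))
    (h2 : IsIrreducibleMat (Xᵀ * X))
    (h4 : ∀ μ : ℝ, hasEigen (X * Xᵀ) μ → μ < 4) :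
    IsStaircase X ∨ IsExtStaircase X ∨
      PermEquiv X Xone ∨ PermEquiv X Xoneᵀ ∨
      PermEquiv X Xtwo ∨ PermEquiv X Xtwoᵀ ∨
      PermEquiv X Xthree ∨ PermEquiv X Xthreeᵀ := by
  have h4' : ∀ μ : ℝ, ∀ v : Fin p → ℝ, v ≠ 0 → (X * Xᵀ).mulVec v = μ • v → μ < 4 :=
    fun μ v hv h => h4 μ ⟨v, hv, h⟩
  have h01 : ∀ i j, X i j ≠ 0 → X i j = 1 := fun i j => eq_one_of_ne_zero hnat h4'
  have hG := noSubharmonic_bipGraph hnat h4'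
  obtain ⟨i₀, j₀, hij⟩ : ∃ i j, X i j ≠ 0 := by
    by_contra! hcon
    exact hX (Matrix.ext hcon)
  have : Nonempty (Fin p ⊕ Fin q) := ⟨Sum.inl i₀⟩
  obtain ⟨n, h, ⟨hf, hsurj⟩ | ⟨i, hb, hsurj, ⟨hn, hi⟩ | ⟨rfl, hn4, hn6⟩⟩⟩ :=
    hG.exists_path_or_branch (bipGraph_closed_eq_univ h1 h2)
  · refine Or.inl (hf.isStaircase h01 hG ?_ hsurj)
    by_contra hn
    obtain ⟨a, ha, ha'⟩ := hsurj (Sum.inl i₀)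
    obtain ⟨b, hb, hb'⟩ := hsurj (Sum.inr j₀)
    rw [show a = b by omega, hb'] at ha'
    exact absurd ha' (by simp)
  · exact Or.inr (Or.inl (hb.isExtStaircase h01 hG hsurj hn hi))
  · interval_cases n
    · have := hb.permEquiv_of_two h01 hG hsurj Xone ![0, 2, 4] ![1, 5, 3] (by decide) (by decide)
        (by decide) (by decide) (by decide)
        (by intro i j; fin_cases i <;> fin_cases j <;> simp [Xone])
      tauto
    · have := hb.permEquiv_of_two h01 hG hsurj Xtwo ![4, 2, 0] ![5, 3, 6, 1] (by decide)
        (by decide) (by decide) (by decide) (by decide)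
        (by intro i j; fin_cases i <;> fin_cases j <;> simp [Xtwo])
      tauto
    · have := hb.permEquiv_of_two h01 hG hsurj Xthree ![6, 4, 2, 0] ![5, 3, 7, 1] (by decide)
        (by decide) (by decide) (by decide) (by decide)
        (by intro i j; fin_cases i <;> fin_cases j <;> simp [Xthree])
      tauto
end

section
/- Let X be a matrix with nonnegative integer entries. Suppose that either (i) there exist two distinct row indices i ≠ i' and two distinct column indices j ≠ j' such that the four entries X(i,j), X(i,j'), X(i',j), X(i',j') are all nonzero, or (ii) some row or some column of X contains at least four nonzero entries. Then the largest eigenvalue of X·Xᵀ is greater than or equal to 4. -/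
open Matrix

/-- A real symmetric matrix has an eigenvalue at least any lower bound of its Rayleigh quotient at
a nonzero vector. -/
theorem exists_hasEigen_ge {n : ℕ} {A : Matrix (Fin n) (Fin n) ℝ} (hA : A.IsHermitian) {c : ℝ}
    {w : Fin n → ℝ} (hw : w ≠ 0) (hc : c * (w ⬝ᵥ w) ≤ w ⬝ᵥ A *ᵥ w) :
    ∃ μ : ℝ, hasEigen A μ ∧ c ≤ μ := by
  have hB : (c • (1 : Matrix (Fin n) (Fin n) ℝ) - A).IsHermitian := by
    refine IsHermitian.sub ?_ hA
    simp [IsHermitian]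
  by_contra! hlt
  have hpos : (c • (1 : Matrix (Fin n) (Fin n) ℝ) - A).PosDef := by
    refine hB.posDef_iff_eigenvalues_pos.2 fun i => ?_
    have hv := hB.mulVec_eigenvectorBasis i
    have hne : (⇑(hB.eigenvectorBasis i) : Fin n → ℝ) ≠ 0 := by
      intro h0
      exact hB.eigenvectorBasis.orthonormal.ne_zero i (by ext k; exact congrFun h0 k)
    have hlt' := hlt (c - hB.eigenvalues i) ⟨_, hne, by
      rw [sub_mulVec, smul_mulVec, one_mulVec] at hv
      rw [sub_smul, ← hv, sub_sub_cancel]⟩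
    linarith
  have h := hpos.dotProduct_mulVec_pos hw
  rw [star_trivial, sub_mulVec, smul_mulVec, one_mulVec, dotProduct_sub, dotProduct_smul,
    smul_eq_mul] at h
  linarith

/-- If the column sums of `X` over a nonempty set `s` of rows have squares of sum at least
`c * #s`, then `X * Xᵀ` has an eigenvalue at least `c`. -/
theorem exists_hasEigen_mul_transpose_ge {p q : ℕ} (X : Matrix (Fin p) (Fin q) ℝ) {c : ℝ}
    {s : Finset (Fin p)} (hs : s.Nonempty)
    (hc : c * s.card ≤ ∑ j, (∑ i ∈ s, X i j) ^ 2) :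
    ∃ μ : ℝ, hasEigen (X * Xᵀ) μ ∧ c ≤ μ := by
  have hA : (X * Xᵀ).IsHermitian := by
    simpa using isHermitian_mul_conjTranspose_self X
  obtain ⟨k, hk⟩ := hs
  refine exists_hasEigen_ge hA (w := fun i => if i ∈ s then 1 else 0)
    (fun h0 => by simpa [hk] using congrFun h0 k) ?_
  rw [← mulVec_mulVec, dotProduct_mulVec, mulVec_transpose]
  simpa [dotProduct, vecMul, pow_two] using hc

/-- if a matrix `X` with nonnegative integer entries contains a `2×2`
all-nonzero submatrix, or has a row or a column with at least four nonzero entries,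
then the largest eigenvalue of `X·Xᵀ` is at least `4`. -/
theorem statement3 {p q : ℕ} (X : Matrix (Fin p) (Fin q) ℝ)
    (hnat : ∀ i j, ∃ n : ℕ, X i j = (n : ℝ))
    (h : (∃ i i' : Fin p, ∃ j j' : Fin q, i ≠ i' ∧ j ≠ j' ∧
            X i j ≠ 0 ∧ X i j' ≠ 0 ∧ X i' j ≠ 0 ∧ X i' j' ≠ 0) ∨
         (∃ i : Fin p, 4 ≤ (Finset.univ.filter fun j => X i j ≠ 0).card) ∨
         (∃ j : Fin q, 4 ≤ (Finset.univ.filter fun i => X i j ≠ 0).card)) :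
    ∃ μ : ℝ, hasEigen (X * Xᵀ) μ ∧ 4 ≤ μ := by
  have one_le {i j} (hij : X i j ≠ 0) : 1 ≤ X i j := by
    obtain ⟨n, hn⟩ := hnat i j
    rw [hn] at hij ⊢
    exact_mod_cast Nat.one_le_iff_ne_zero.2 (by exact_mod_cast hij)
  rcases h with ⟨i, i', j, j', hi, hj, h1, h2, h3, h4⟩ | ⟨i, hcard⟩ | ⟨j, hcard⟩
  · refine exists_hasEigen_mul_transpose_ge X (s := {i, i'}) (by simp) ?_
    have hle := Finset.sum_le_univ_sum_of_nonneg (s := {j, j'})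
      (f := fun l => (∑ k ∈ {i, i'}, X k l) ^ 2) fun l => sq_nonneg _
    refine le_trans ?_ hle
    rw [Finset.card_pair hi, Finset.sum_pair hj, Finset.sum_pair hi, Finset.sum_pair hi]
    push_cast
    nlinarith [one_le h1, one_le h2, one_le h3, one_le h4]
  · refine exists_hasEigen_mul_transpose_ge X (s := {i}) (by simp) ?_
    have hle := Finset.sum_le_univ_sum_of_nonneg (s := Finset.univ.filter fun j => X i j ≠ 0)
      (f := fun l => (∑ k ∈ {i}, X k l) ^ 2) fun l => sq_nonneg _
    refine le_trans ?_ hle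
    have hsum := Finset.card_nsmul_le_sum (Finset.univ.filter fun j => X i j ≠ 0)
      (fun l => (∑ k ∈ {i}, X k l) ^ 2) 1 fun l hl => by
        rw [Finset.sum_singleton]
        exact one_le_pow₀ (one_le (Finset.mem_filter.1 hl).2)
    refine le_trans ?_ hsum
    simpa using (by exact_mod_cast hcard :
      (4 : ℝ) ≤ (Finset.univ.filter fun j => X i j ≠ 0).card)
  · refine exists_hasEigen_mul_transpose_ge X (s := Finset.univ.filter fun i => X i j ≠ 0)
      (Finset.card_pos.1 (by omega)) ?_
    have hle := Finset.single_le_sum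
      (f := fun l => (∑ k with X k j ≠ 0, X k l) ^ 2) (fun l _ => sq_nonneg _) (Finset.mem_univ j)
    refine le_trans ?_ hle
    have hsum := Finset.card_nsmul_le_sum (Finset.univ.filter fun i => X i j ≠ 0)
      (fun k => X k j) 1 fun k hk => one_le (Finset.mem_filter.1 hk).2
    rw [nsmul_eq_mul, mul_one] at hsum
    have hcard' : (4 : ℝ) ≤ (Finset.univ.filter fun i => X i j ≠ 0).card := by
      exact_mod_cast hcard
    nlinarith
end

section
/- For m ≥ 3, let X be the m×m 0–1 matrix whose rows are r₁ = e₁, r₂ = e₁, r_j = e_{j−2} + e_{j−1} for 3 ≤ j ≤ m−1, and r_m = e_{m−2} + e_{m−1} + e_m, where e_i denotes the i-th standard basis row vector of length m. Then the column vector v with first m−2 entries equal to 2 and last two entries equal to 1 satisfies Xᵀ·X·v = 4·v; in particular, 4 is an eigenvalue of Xᵀ·X. -/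
open Matrix

/-- A sum over a finite type whose terms vanish away from three distinct indices. -/
theorem Fintype.sum_eq_add_add_of_ne {ι M : Type*} [Fintype ι] [AddCommMonoid M]
    {f : ι → M} (a b c : ι) (hab : a ≠ b) (hac : a ≠ c) (hbc : b ≠ c)
    (h : ∀ x, x ≠ a → x ≠ b → x ≠ c → f x = 0) :
    ∑ x, f x = f a + f b + f c := by
  classical
  rw [← Finset.sum_subset (Finset.subset_univ {a, b, c}) (by
    intro x _ hx
    simp only [Finset.mem_insert, Finset.mem_singleton, not_or] at hx
    exact h x hx.1 hx.2.1 hx.2.2)]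
  rw [Finset.sum_insert (by simp [hab, hac]), Finset.sum_pair hbc, add_assoc]

/-- for `m ≥ 3`, the `m×m` 0-1 matrix with rows (1-indexed)
`r₁ = e₁`, `r₂ = e₁`, `r_j = e_{j−2} + e_{j−1}` for `3 ≤ j ≤ m−1`, and
`r_m = e_{m−2} + e_{m−1} + e_m` (written below 0-indexed) satisfies
`Xᵀ·X·v = 4·v`, where `v = (2,…,2,1,1)ᵀ`; in particular `4` is an eigenvalue of `Xᵀ·X`. -/
theorem statement4 (m : ℕ) (hm : 3 ≤ m)
    (X : Matrix (Fin m) (Fin m) ℝ)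
    (hX : ∀ i j : Fin m, X i j =
      if ((i : ℕ) ≤ 1 ∧ (j : ℕ) = 0) ∨
         (2 ≤ (i : ℕ) ∧ (i : ℕ) ≤ m - 2 ∧
            ((j : ℕ) = (i : ℕ) - 2 ∨ (j : ℕ) = (i : ℕ) - 1)) ∨
         ((i : ℕ) = m - 1 ∧ ((j : ℕ) = m - 3 ∨ (j : ℕ) = m - 2 ∨ (j : ℕ) = m - 1))
      then 1 else 0)
    (v : Fin m → ℝ)
    (hv : ∀ i : Fin m, v i = if (i : ℕ) < m - 2 then 2 else 1) :
    (Xᵀ * X).mulVec v = (4 : ℝ) • v ∧ hasEigen (Xᵀ * X) 4 := by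
  have hXv : ∀ i : Fin m, X.mulVec v i = if (i : ℕ) ≤ 1 then 2 else 4 := by
    intro i
    simp only [mulVec, dotProduct, hX, hv]
    have hi := i.isLt
    by_cases h₁ : (i : ℕ) ≤ 1
    · rw [Fintype.sum_eq_single ⟨0, by omega⟩]
      · grind
      · grind [Fin.ext_iff]
    · by_cases h₂ : (i : ℕ) = m - 1
      · rw [Fintype.sum_eq_add_add_of_ne ⟨m - 3, by omega⟩ ⟨m - 2, by omega⟩ ⟨m - 1, by omega⟩]
        all_goals grind [Fin.ext_iff]
      · rw [Fintype.sum_eq_add ⟨i - 2, by omega⟩ ⟨i - 1, by omega⟩]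
        all_goals grind [Fin.ext_iff]
  have key : (Xᵀ * X).mulVec v = (4 : ℝ) • v := by
    rw [← mulVec_mulVec]
    ext j
    simp only [mulVec.eq_1 Xᵀ, dotProduct, transpose_apply, hXv, hX, Pi.smul_apply, smul_eq_mul, hv]
    have hj := j.isLt
    by_cases h₀ : (j : ℕ) = 0
    · rw [Fintype.sum_eq_add_add_of_ne ⟨0, by omega⟩ ⟨1, by omega⟩ ⟨2, by omega⟩]
      all_goals grind [Fin.ext_iff]
    · by_cases h₁ : (j : ℕ) < m - 2
      · rw [Fintype.sum_eq_add ⟨j + 1, by omega⟩ ⟨j + 2, by omega⟩]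
        all_goals grind [Fin.ext_iff]
      · rw [Fintype.sum_eq_single ⟨m - 1, by omega⟩]
        all_goals grind [Fin.ext_iff]
  refine ⟨key, v, fun h => ?_, key⟩
  have h₀ := hv ⟨0, by omega⟩
  rw [h, if_pos (by simp only; omega)] at h₀
  norm_num at h₀
end

section
/- For every odd i ≥ 1, the polynomial identity (−1)^{⌊i/2⌋} · f_i(−x²) = g_i(x) holds in ℤ[x], and for every even i ≥ 0, the polynomial identity (−1)^{i/2} · f_i(−x²) = x · g_i(x) holds in ℤ[x], where f_i(−x²) denotes the composition of f_i with the polynomial −x². -/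
open Polynomial

/-- `f₀ = 0`, `f₁ = 1`, `fᵢ = f_{i−1} − f_{i−2}` for odd `i ≥ 2` and
`fᵢ = x·f_{i−1} − f_{i−2}` for even `i ≥ 2`. -/
noncomputable def fpoly : ℕ → Polynomial ℤ
  | 0 => 0
  | 1 => 1
  | (n + 2) =>
      if (n + 2) % 2 = 1 then fpoly (n + 1) - fpoly n
      else X * fpoly (n + 1) - fpoly n

/-- The Fibonacci polynomials: `g₀ = 0`, `g₁ = 1`, `gᵢ = x·g_{i−1} + g_{i−2}`. -/
noncomputable def gpoly : ℕ → Polynomial ℤ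
  | 0 => 0
  | 1 => 1
  | (n + 2) => X * gpoly (n + 1) + gpoly n

theorem fpoly_even (k : ℕ) : fpoly (2 * k + 2) = X * fpoly (2 * k + 1) - fpoly (2 * k) := by
  rw [fpoly, if_neg (by omega)]

theorem fpoly_odd (k : ℕ) : fpoly (2 * k + 3) = fpoly (2 * k + 2) - fpoly (2 * k + 1) := by
  rw [fpoly, if_pos (by omega)]

theorem gpoly_add_two (n : ℕ) : gpoly (n + 2) = X * gpoly (n + 1) + gpoly n := by
  rw [gpoly]

theorem fpoly_comp_neg_sq (k : ℕ) :
    (-1 : Polynomial ℤ) ^ k * (fpoly (2 * k)).comp (-X ^ 2) = X * gpoly (2 * k) ∧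
    (-1 : Polynomial ℤ) ^ k * (fpoly (2 * k + 1)).comp (-X ^ 2) = gpoly (2 * k + 1) := by
  induction k with
  | zero => simp [fpoly, gpoly]
  | succ k ih =>
    obtain ⟨h_even, h_odd⟩ := ih
    have h_even_succ : (-1 : Polynomial ℤ) ^ (k + 1) * (fpoly (2 * k + 2)).comp (-X ^ 2) =
        X * gpoly (2 * k + 2) := by
      rw [fpoly_even, gpoly_add_two, sub_comp, mul_comp, X_comp]
      linear_combination X ^ 2 * h_odd + h_even
    refine ⟨h_even_succ, ?_⟩
    change (-1 : Polynomial ℤ) ^ (k + 1) * (fpoly (2 * k + 3)).comp (-X ^ 2) = gpoly (2 * k + 3)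
    rw [fpoly_odd, gpoly_add_two, sub_comp]
    linear_combination h_even_succ + h_odd

/-- `(−1)^⌊i/2⌋·fᵢ(−x²) = gᵢ(x)` for odd `i`, and
`(−1)^{i/2}·fᵢ(−x²) = x·gᵢ(x)` for even `i`. -/
theorem statement6 (i : ℕ) :
    (i % 2 = 1 →
      (-1 : Polynomial ℤ) ^ (i / 2) * (fpoly i).comp (-X ^ 2) = gpoly i) ∧
    (i % 2 = 0 →
      (-1 : Polynomial ℤ) ^ (i / 2) * (fpoly i).comp (-X ^ 2) = X * gpoly i) := by
  constructor <;> intro h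
  · obtain ⟨k, rfl⟩ : ∃ k, i = 2 * k + 1 := ⟨i / 2, by omega⟩
    rw [show (2 * k + 1) / 2 = k by omega]
    exact (fpoly_comp_neg_sq k).2
  · obtain ⟨k, rfl⟩ : ∃ k, i = 2 * k := ⟨i / 2, by omega⟩
    rw [show 2 * k / 2 = k by omega]
    exact (fpoly_comp_neg_sq k).1
end

section
/- Let n ≥ 1 be odd and let B be a real p×q matrix such that f_n(B·Bᵀ) = 0 and f_n(Bᵀ·B) = 0. Then p = q and B is invertible. -/
open Matrix Polynomial

theorem fpoly_coeff_zero (k : ℕ) :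
    (fpoly (2 * k)).coeff 0 = 0 ∧ (fpoly (2 * k + 1)).coeff 0 = (-1) ^ k := by
  induction k with
  | zero => simp [fpoly]
  | succ k ih =>
    have h_even : (fpoly (2 * k + 2)).coeff 0 = 0 := by
      rw [fpoly, if_neg (by omega)]
      simp [ih.1]
    refine ⟨h_even, ?_⟩
    rw [show 2 * (k + 1) + 1 = 2 * k + 1 + 2 by ring, fpoly, if_pos (by omega)]
    simp [h_even, ih.2, pow_succ]

/-- A root of an integer polynomial whose constant coefficient is a unit is invertible. -/
theorem exists_mul_aeval_eq_one {A : Type*} [Ring A] {f : Polynomial ℤ}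
    (hf : IsUnit (f.coeff 0)) {a : A} (ha : aeval a f = 0) :
    ∃ g : Polynomial ℤ, a * aeval a g = 1 ∧ aeval a g * a = 1 := by
  obtain ⟨c, hc⟩ := hf.exists_left_inv
  have h : X * (C (-c) * f.divX) = 1 + C (-c) * f := by
    conv_rhs => rw [← X_mul_divX_add f, mul_add, ← C_mul, neg_mul, hc]
    simp only [map_neg, map_one]
    ring
  have key : aeval a (X * (C (-c) * f.divX)) = 1 := by
    rw [h, map_add, map_mul, ha, mul_zero, add_zero, map_one]
  refine ⟨C (-c) * f.divX, ?_, ?_⟩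
  · rwa [map_mul, aeval_X] at key
  · rwa [mul_comm X, map_mul _ _ X, aeval_X] at key

/-- if `n` is odd and `B` is a real `p×q` matrix with
`fₙ(B·Bᵀ) = 0` and `fₙ(Bᵀ·B) = 0`, then `p = q` and `B` is invertible. -/
theorem statement11 {p q : ℕ} (n : ℕ) (hn : n % 2 = 1)
    (B : Matrix (Fin p) (Fin q) ℝ)
    (h1 : aeval (B * Bᵀ) (fpoly n) = 0)
    (h2 : aeval (Bᵀ * B) (fpoly n) = 0) :
    p = q ∧ ∃ L : Matrix (Fin q) (Fin p) ℝ, B * L = 1 ∧ L * B = 1 := by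
  have hu : IsUnit ((fpoly n).coeff 0) := by
    obtain ⟨k, rfl⟩ : ∃ k, n = 2 * k + 1 := ⟨n / 2, by omega⟩
    rw [(fpoly_coeff_zero k).2]
    exact isUnit_one.neg.pow k
  obtain ⟨g, hg, -⟩ := exists_mul_aeval_eq_one hu h1
  obtain ⟨g', -, hg'⟩ := exists_mul_aeval_eq_one hu h2
  obtain ⟨R, hR⟩ : ∃ R : Matrix (Fin q) (Fin p) ℝ, B * R = 1 :=
    ⟨Bᵀ * aeval (B * Bᵀ) g, (Matrix.mul_assoc _ _ _).symm.trans hg⟩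
  obtain ⟨L, hL⟩ : ∃ L : Matrix (Fin q) (Fin p) ℝ, L * B = 1 :=
    ⟨aeval (Bᵀ * B) g' * Bᵀ, (Matrix.mul_assoc _ _ _).trans hg'⟩
  have hLR : L = R := by
    rw [← Matrix.mul_one L, ← hR, ← Matrix.mul_assoc, hL, Matrix.one_mul]
  rw [hLR] at hL
  refine ⟨?_, R, hR, hL⟩
  have ht := Matrix.trace_mul_comm B R
  rw [hR, hL, Matrix.trace_one, Matrix.trace_one, Fintype.card_fin, Fintype.card_fin] at ht
  exact_mod_cast ht
end

section
/- Let A be the real symmetric 6×6 matrix [[2,0,1,0,0,0],[0,2,1,1,0,0],[1,1,2,0,1,0],[0,1,0,2,0,1],[0,0,1,0,2,0],[0,0,0,1,0,2]] and let B be the real symmetric 3×3 matrix [[2, −(1+√5)/2, 0],[−(1+√5)/2, 2, −1],[0, −1, 2]]. Then λ = 2 + √(2√5 + 10)/2 is an eigenvalue of both A and B, and every eigenvalue μ of A satisfies |μ| ≤ λ. -/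
open Matrix

noncomputable def A6 : Matrix (Fin 6) (Fin 6) ℝ :=
  !![2,0,1,0,0,0; 0,2,1,1,0,0; 1,1,2,0,1,0; 0,1,0,2,0,1; 0,0,1,0,2,0; 0,0,0,1,0,2]

noncomputable def B3 : Matrix (Fin 3) (Fin 3) ℝ :=
  !![2, -(1 + Real.sqrt 5)/2, 0;
     -(1 + Real.sqrt 5)/2, 2, -1;
     0, -1, 2]

/-- Half of `√(2√5 + 10)` squares to `(1 + √5) / 2 + 2`. -/
lemma half_sqrt_sq :
    (Real.sqrt (2 * Real.sqrt 5 + 10) / 2) ^ 2 = (1 + Real.sqrt 5) / 2 + 2 := by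
  rw [div_pow, Real.sq_sqrt (by positivity)]
  ring

/-- An eigenvalue `ν + 2` of `A6` satisfies the equation `ν (ν⁴ - 5 ν² + 5) = 0`. -/
lemma eigen_A6_equation {ν : ℝ} (h : hasEigen A6 (2 + ν)) :
    ν * (ν ^ 4 - 5 * ν ^ 2 + 5) = 0 := by
  obtain ⟨v, hv, hA⟩ := h
  have h0 := congrFun hA 0
  have h1 := congrFun hA 1
  have h2 := congrFun hA 2
  have h3 := congrFun hA 3
  have h4 := congrFun hA 4
  have h5 := congrFun hA 5
  simp [A6, Matrix.mulVec, dotProduct, Fin.sum_univ_succ] at h0 h1 h2 h3 h4 h5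
  ring_nf at h0 h1 h2 h3 h4 h5
  have e0 : v 2 = ν * v 0 := by linear_combination h0
  have e4 : v 2 = ν * v 4 := by linear_combination h4
  have e3 : v 3 = ν * v 5 := by linear_combination h5
  have e1 : v 1 = (ν ^ 2 - 1) * v 5 := by linear_combination h3 + ν * e3
  have e2 : v 2 = (ν ^ 3 - 2 * ν) * v 5 := by linear_combination h1 + ν * e1 - e3
  by_cases hz : v 5 = 0
  · rw [hz, mul_zero] at e1 e2 e3
    by_cases hν : ν = 0
    · simp [hν]
    · refine absurd (funext fun i => ?_) hv
      have z0 : v 0 = 0 := by simpa [e2, hν] using e0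
      have z4 : v 4 = 0 := by simpa [e2, hν] using e4
      fin_cases i <;> simp_all
  · refine (mul_eq_zero.mp ?_).resolve_right hz
    linear_combination (-ν) * h2 - e0 - e4 + ν * e1 - (ν ^ 2 - 2) * e2

/-- `λ = 2 + √(2√5 + 10)/2` is an eigenvalue of both `A` and `B`, and
every eigenvalue `μ` of `A` satisfies `|μ| ≤ λ`. -/
theorem statement16 :
    hasEigen A6 (2 + Real.sqrt (2 * Real.sqrt 5 + 10) / 2) ∧
    hasEigen B3 (2 + Real.sqrt (2 * Real.sqrt 5 + 10) / 2) ∧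
    ∀ μ : ℝ, hasEigen A6 μ → |μ| ≤ 2 + Real.sqrt (2 * Real.sqrt 5 + 10) / 2 := by
  set s := Real.sqrt 5 with hs
  have hs2 : s ^ 2 = 5 := Real.sq_sqrt (by norm_num)
  have hs0 : 0 ≤ s := Real.sqrt_nonneg 5
  have ht2 := half_sqrt_sq
  rw [← hs] at ht2
  have ht0 : 0 ≤ Real.sqrt (2 * s + 10) / 2 := by positivity
  set t := Real.sqrt (2 * s + 10) / 2
  refine ⟨⟨![(1 + s) / 2, (1 + s) / 2 + 1, t * ((1 + s) / 2), t, (1 + s) / 2, 1], ?_, ?_⟩,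
    ⟨![(1 + s) / 2, -t, 1], ?_, ?_⟩, ?_⟩
  · intro h
    simpa using congrFun h 5
  · ext i
    fin_cases i <;> simp [A6, Matrix.mulVec, dotProduct, Fin.sum_univ_succ]
    · ring
    · ring
    · linear_combination (-(1 + s) / 2) * ht2 - hs2 / 4
    · linear_combination -ht2
    · ring
    · ring
  · intro h
    simpa using congrFun h 2
  · ext i
    fin_cases i <;> simp [B3, Matrix.mulVec, dotProduct, Fin.sum_univ_succ, ← hs]
    · ring
    · linear_combination ht2 - hs2 / 4
    · ring
  · intro μ hμ
    have hν := eigen_A6_equation (ν := μ - 2) (by simpa using hμ)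
    have hsq : (μ - 2) ^ 2 ≤ t ^ 2 := by
      rcases mul_eq_zero.mp hν with h | h
      · simpa [h] using sq_nonneg t
      · nlinarith
    have hle := abs_le.mp (abs_le_of_sq_le_sq hsq ht0)
    rw [abs_le]
    constructor <;> linarith [hle.1, hle.2]
end

section
/- Let A be the real symmetric 8×8 matrix [[2,0,1,0,0,0,0,0],[0,2,1,1,0,0,0,0],[1,1,2,0,1,0,0,0],[0,1,0,2,0,1,0,0],[0,0,1,0,2,0,1,0],[0,0,0,1,0,2,0,1],[0,0,0,0,1,0,2,0],[0,0,0,0,0,1,0,2]] and let B be the real symmetric 4×4 matrix [[2, −(1+√5)/2, 0, 0],[−(1+√5)/2, 2, −1, 0],[0, −1, 2, −1],[0, 0, −1, 2]]. Then A and B have a common real eigenvalue λ such that every eigenvalue μ of A satisfies |μ| ≤ λ and every eigenvalue ν of B satisfies |ν| ≤ λ. -/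
open Matrix

noncomputable def A8 : Matrix (Fin 8) (Fin 8) ℝ :=
  !![2,0,1,0,0,0,0,0;
     0,2,1,1,0,0,0,0;
     1,1,2,0,1,0,0,0;
     0,1,0,2,0,1,0,0;
     0,0,1,0,2,0,1,0;
     0,0,0,1,0,2,0,1;
     0,0,0,0,1,0,2,0;
     0,0,0,0,0,1,0,2]

noncomputable def B4 : Matrix (Fin 4) (Fin 4) ℝ :=
  !![2, -(1 + Real.sqrt 5)/2, 0, 0;
     -(1 + Real.sqrt 5)/2, 2, -1, 0;
     0, -1, 2, -1;
     0, 0, -1, 2]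

/-- An eigenvalue of `A` is bounded by `lam` as soon as the entrywise absolute value of `A` maps
some positive vector `w` below `lam • w`. -/
theorem hasEigen.abs_le_of_sum_abs_mul_le {n : ℕ} {A : Matrix (Fin n) (Fin n) ℝ} {μ lam : ℝ}
    {w : Fin n → ℝ} (hw : ∀ i, 0 < w i) (hA : ∀ i, ∑ j, |A i j| * w j ≤ lam * w i)
    (h : hasEigen A μ) : |μ| ≤ lam := by
  obtain ⟨v, hv, hAv⟩ := h
  obtain ⟨k, hk⟩ := Function.ne_iff.mp hv
  obtain ⟨i, -, hi⟩ := Finset.exists_max_image Finset.univ (fun i => |v i| / w i) ⟨k, by simp⟩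
  set m := |v i| / w i with hm
  have hm_pos : 0 < m := lt_of_lt_of_le (div_pos (abs_pos.mpr hk) (hw k)) (hi k (by simp))
  have hvm (j : Fin n) : |v j| ≤ m * w j := (div_le_iff₀ (hw j)).mp (hi j (by simp))
  have hvi : |v i| = m * w i := by rw [hm, div_mul_cancel₀ _ (hw i).ne']
  have hrow : ∑ j, A i j * v j = μ * v i := congrFun hAv i
  have key : |μ| * (m * w i) ≤ lam * (m * w i) := calc
    |μ| * (m * w i) = |∑ j, A i j * v j| := by rw [hrow, abs_mul, hvi]
    _ ≤ ∑ j, |A i j * v j| := Finset.abs_sum_le_sum_abs _ _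
    _ ≤ ∑ j, m * (|A i j| * w j) := by
      refine Finset.sum_le_sum fun j _ => ?_
      rw [abs_mul]
      nlinarith [mul_le_mul_of_nonneg_left (hvm j) (abs_nonneg (A i j))]
    _ = m * ∑ j, |A i j| * w j := by rw [Finset.mul_sum]
    _ ≤ m * (lam * w i) := mul_le_mul_of_nonneg_left (hA i) hm_pos.le
    _ = lam * (m * w i) := by ring
  exact le_of_mul_le_mul_right key (mul_pos hm_pos (hw i))

theorem B4_eq_goldenRatio : B4 =
    !![2, -Real.goldenRatio, 0, 0; -Real.goldenRatio, 2, -1, 0; 0, -1, 2, -1; 0, 0, -1, 2] := by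
  have h : -(1 + Real.sqrt 5) / 2 = -Real.goldenRatio := by rw [Real.goldenRatio]; ring
  rw [B4, h]

/-- The largest root of `t ^ 4 - (φ ^ 2 + 2) * t ^ 2 + φ ^ 2`, namely `2 * cos (π / 30)`. -/
theorem exists_root_goldenRatio : ∃ t : ℝ, 0 < t ∧ 2 < t ^ 2 ∧
    t ^ 4 - (Real.goldenRatio ^ 2 + 2) * t ^ 2 + Real.goldenRatio ^ 2 = 0 := by
  set p := Real.goldenRatio
  have hp1 : 1 < p := Real.one_lt_goldenRatio
  have hp2 : p ^ 2 = p + 1 := Real.goldenRatio_sq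
  set r := Real.sqrt (3 * p + 6)
  have hr0 : 0 ≤ r := Real.sqrt_nonneg _
  have hr2 : r ^ 2 = 3 * p + 6 := Real.sq_sqrt (by linarith)
  have hs : 2 < (p + 3 + r) / 2 := by linarith
  have ht2 : Real.sqrt ((p + 3 + r) / 2) ^ 2 = (p + 3 + r) / 2 := Real.sq_sqrt (by linarith)
  refine ⟨Real.sqrt ((p + 3 + r) / 2), Real.sqrt_pos.mpr (by linarith), by rwa [ht2], ?_⟩
  rw [show ∀ x : ℝ, x ^ 4 = (x ^ 2) ^ 2 from fun x => by ring, ht2, hp2]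
  linear_combination hr2 / 4 - hp2 / 4

/-- the matrices `A` and `B` have a common real eigenvalue `λ` which
bounds the absolute value of every eigenvalue of `A` and of every eigenvalue of `B`. -/
theorem statement17 :
    ∃ lam : ℝ, hasEigen A8 lam ∧ hasEigen B4 lam ∧
      (∀ μ : ℝ, hasEigen A8 μ → |μ| ≤ lam) ∧
      (∀ ν : ℝ, hasEigen B4 ν → |ν| ≤ lam) := by
  obtain ⟨t, ht, ht2, hroot⟩ := exists_root_goldenRatio
  have hp1 : 1 < Real.goldenRatio := Real.one_lt_goldenRatio
  have hp2 : Real.goldenRatio ^ 2 = Real.goldenRatio + 1 := Real.goldenRatio_sq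
  rw [B4_eq_goldenRatio]
  generalize Real.goldenRatio = p at *
  have hp0 : 0 < p := by linarith
  -- `(y, z, t, 1)` is the Perron eigenvector of the entrywise absolute value of `B4`;
  -- the one of `A8` is assembled from it and its multiple by the golden ratio.
  obtain ⟨z, hz⟩ : ∃ z, z = t ^ 2 - 1 := ⟨_, rfl⟩
  obtain ⟨y, hy⟩ : ∃ y, y = (p - 1) * (t ^ 3 - 2 * t) := ⟨_, rfl⟩
  have hz0 : 0 < z := by linarith
  have hy0 : 0 < y := by
    rw [hy, show t ^ 3 - 2 * t = t * (t ^ 2 - 2) by ring]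
    exact mul_pos (by linarith) (mul_pos ht (by linarith))
  have hpy : p * y = t * z - t := by
    rw [hy, hz]; linear_combination (t ^ 3 - 2 * t) * hp2
  have hty : t * y = p * z := by
    have : p * (t * y) = p * (p * z) := by
      rw [hz] at *
      linear_combination t * hpy + hroot
    exact mul_left_cancel₀ hp0.ne' this
  have hA : A8 *ᵥ ![y, p * y, p * z, z, p * t, t, p, 1] =
      (2 + t) • ![y, p * y, p * z, z, p * t, t, p, 1] := by
    ext i
    fin_cases i <;> simp [A8, mulVec, dotProduct, Fin.sum_univ_succ]
    · linear_combination -hty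
    · linear_combination -z * hp2 - p * hty
    · linear_combination p * hpy - y * hp2
    · linear_combination hpy
    · linear_combination p * hz
    · linear_combination hz
    · ring
    · ring
  refine ⟨2 + t, ⟨_, fun h => ?_, hA⟩, ⟨![-y, z, -t, 1], fun h => ?_, ?_⟩, fun μ hμ => ?_,
    fun ν hν => ?_⟩
  · simpa using congrFun h 7
  · simpa using congrFun h 3
  · ext i
    fin_cases i <;> simp [mulVec, dotProduct, Fin.sum_univ_succ]
    · linear_combination hty
    · linear_combination hpy
    · linear_combination -hz
    · ring
  · refine hμ.abs_le_of_sum_abs_mul_le (w := ![y, p * y, p * z, z, p * t, t, p, 1]) (fun i => ?_)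
      fun i => ?_
    · fin_cases i <;> simp <;> positivity
    · have habs (j : Fin 8) : |A8 i j| = A8 i j :=
        abs_of_nonneg (by fin_cases i <;> fin_cases j <;> simp [A8])
      simp only [habs]
      exact (congrFun hA i).le
  · refine hν.abs_le_of_sum_abs_mul_le (w := ![y, z, t, 1]) (fun i => ?_) fun i => ?_
    · fin_cases i <;> simp <;> positivity
    · fin_cases i <;> simp [Fin.sum_univ_succ, abs_of_pos hp0]
      · linear_combination -hty
      · linear_combination hpy
      · linear_combination hz
      · linarith
end

section
/- Let 𝕜 be an algebraically closed field with characteristic different from 2, let V be a finite-dimensional 𝕜-vector space, and let g : V → V be an invertible 𝕜-linear endomorphism. Then there exists a polynomial p ∈ 𝕜[x] such that (p(g))² = g; in particular, g has a square root in the subalgebra 𝕜[g] of End(V), which therefore commutes with g. -/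
open Polynomial in
/-- If `q` vanishes at every root of a nonzero split polynomial `m`, then `m` divides a power
of `q`. -/
theorem Polynomial.Splits.exists_dvd_pow_of_eval_eq_zero {K : Type*} [Field K] {m q : K[X]}
    (hs : m.Splits) (hm : m.Monic) (hq : ∀ a ∈ m.roots, q.eval a = 0) :
    ∃ n : ℕ, m ∣ q ^ n := by
  refine ⟨(m.roots.map fun a ↦ X - C a).card, ?_⟩
  conv_lhs => rw [hs.eq_prod_roots_of_monic hm]
  have h : ∀ p ∈ m.roots.map fun a ↦ X - C a, p ∣ q := by
    intro p hp
    obtain ⟨a, ha, rfl⟩ := Multiset.mem_map.mp hp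
    exact dvd_iff_isRoot.mpr (hq a ha)
  generalize m.roots.map (fun a ↦ X - C a) = s at h
  induction s using Multiset.induction_on with
  | empty => simp
  | cons p s ih =>
    rw [Multiset.prod_cons, Multiset.card_cons, pow_succ']
    exact mul_dvd_mul (h p (Multiset.mem_cons_self p s))
      (ih fun r hr ↦ h r (Multiset.mem_cons_of_mem hr))

open Polynomial in
/-- In a commutative ring where `2` is a unit, a unit that is a square up to a nilpotent
is a square. -/
theorem IsUnit.exists_sq_eq_of_isNilpotent_sq_sub {R : Type*} [CommRing R]
    (h2 : IsUnit (2 : R)) {a x : R} (ha : IsUnit a) (hx : IsNilpotent (x ^ 2 - a)) :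
    ∃ r : R, r ^ 2 = a := by
  have hxu : IsUnit x := by
    have h := hx.isUnit_add_left_of_commute ha (Commute.all _ _)
    rw [add_sub_cancel] at h
    exact (isUnit_pow_iff two_ne_zero).mp h
  obtain ⟨r, ⟨-, hr⟩, -⟩ := existsUnique_nilpotent_sub_and_aeval_eq_zero
    (P := X ^ 2 - C a) (x := x) (by simpa using hx) (by simpa [one_add_one_eq_two] using And.intro h2 hxu)
  exact ⟨r, by simpa [sub_eq_zero] using hr⟩

open Polynomial in
/-- over an algebraically closed field of characteristic `≠ 2`, every
invertible endomorphism `g` of a finite-dimensional vector space has a square root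
which is a polynomial in `g`; in particular this square root commutes with `g`. -/
theorem statement18 {𝕜 : Type*} [Field 𝕜] [IsAlgClosed 𝕜] (hchar : ringChar 𝕜 ≠ 2)
    {V : Type*} [AddCommGroup V] [Module 𝕜 V] [FiniteDimensional 𝕜 V]
    (g : Module.End 𝕜 V) (hg : IsUnit g) :
    ∃ p : Polynomial 𝕜,
      Polynomial.aeval g p * Polynomial.aeval g p = g ∧
      Commute (Polynomial.aeval g p) g := by
  classical
  choose sqrt hsqrt using fun a : 𝕜 ↦ IsAlgClosed.exists_pow_nat_eq a two_pos
  set m := minpoly 𝕜 g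
  let p₀ : 𝕜[X] := Lagrange.interpolate m.roots.toFinset id sqrt
  obtain ⟨n, hn⟩ : ∃ n : ℕ, m ∣ (p₀ ^ 2 - X) ^ n := by
    refine (IsAlgClosed.splits m).exists_dvd_pow_of_eval_eq_zero
      (minpoly.monic (Algebra.IsIntegral.isIntegral g)) fun a ha ↦ ?_
    have h : p₀.eval a = sqrt a := Lagrange.eval_interpolate_at_node sqrt
      (Set.injOn_id _) (Multiset.mem_toFinset.mpr ha)
    simp [h, hsqrt]
  let A := Algebra.adjoin 𝕜 {g}
  let a : A := ⟨g, Algebra.self_mem_adjoin_singleton 𝕜 g⟩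
  have ha : IsUnit a := by
    have : IsArtinianRing A := IsArtinianRing.of_finite 𝕜 A
    refine IsArtinianRing.isUnit_of_mem_nonZeroDivisors
      (mem_nonZeroDivisors_iff_right.mpr fun z hz ↦ Subtype.ext ?_)
    exact hg.mul_left_eq_zero.mp (congrArg Subtype.val hz)
  have h2 : IsUnit (2 : A) := by
    have h := (Ring.two_ne_zero hchar).isUnit.map (algebraMap 𝕜 A)
    rwa [map_ofNat] at h
  have hnil : IsNilpotent ((aeval a p₀) ^ 2 - a) := by
    refine ⟨n, Subtype.ext ?_⟩
    have h := aeval_eq_zero_of_dvd_aeval_eq_zero hn (minpoly.aeval 𝕜 g)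
    simpa [a] using h
  obtain ⟨r, hr⟩ := h2.exists_sq_eq_of_isNilpotent_sq_sub ha hnil
  obtain ⟨p, hp⟩ := (Algebra.adjoin_singleton_eq_range_aeval 𝕜 g).le r.2
  refine ⟨p, ?_, ?_⟩
  · have hp' : aeval g p = r := hp
    rw [hp', ← sq]
    exact congrArg Subtype.val hr
  · simpa using (Commute.all p X).map (aeval g)
end

section
/- Let 𝕜 be an algebraically closed field with characteristic different from 2, let A be a 𝕜-algebra, let ι : A → A be a 𝕜-algebra automorphism with ι ∘ ι = id_A, and let M be an A-module that is finite-dimensional over 𝕜. If there exists a bijective 𝕜-linear map α : M → M satisfying α(a·m) = ι(a)·α(m) for all a ∈ A and m ∈ M, then there exists a bijective 𝕜-linear map α' : M → M satisfying α'(a·m) = ι(a)·α'(m) for all a ∈ A and m ∈ M and additionally α' ∘ α' = id_M. -/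
open Polynomial in
/-- Modulo a product of linear factors with nonzero roots, `X` has an inverse square root. -/
theorem exists_prod_X_sub_C_dvd_X_mul_sq_sub_one {K : Type*} [Field K] [IsAlgClosed K]
    (h2 : (2 : K) ≠ 0) (s : Multiset K) (hs : ∀ c ∈ s, c ≠ 0) :
    ∃ p : K[X], (s.map fun c => X - C c).prod ∣ X * p ^ 2 - 1 := by
  induction s using Multiset.induction_on with
  | empty => exact ⟨0, by simp⟩
  | cons c s ih =>
    obtain ⟨p, h, hp⟩ := ih fun d hd => hs d (Multiset.mem_cons_of_mem hd)
    have hc : c ≠ 0 := hs c (Multiset.mem_cons_self c s)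
    simp only [Multiset.map_cons, Multiset.prod_cons]
    set q := (s.map fun c => X - C c).prod
    obtain ⟨r, hr⟩ : ∃ r : K, c * q.eval c * r ^ 2 + 2 * c * p.eval c * r + h.eval c = 0 := by
      have hpc : c * p.eval c ^ 2 - 1 = q.eval c * h.eval c := by
        simpa using congrArg (eval c) hp
      by_cases hq : q.eval c = 0
      · have hpc0 : p.eval c ≠ 0 := by
          intro h0
          simp [hq, h0] at hpc
        refine ⟨-h.eval c / (2 * c * p.eval c), ?_⟩
        rw [hq]
        field_simp
        ring
      · have hdeg := degree_quadratic (b := 2 * c * p.eval c) (c := h.eval c) (mul_ne_zero hc hq)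
        obtain ⟨r, hr⟩ := IsAlgClosed.exists_root _ (hdeg.trans_ne (by decide))
        exact ⟨r, by simpa using hr⟩
    refine ⟨p + q * C r, ?_⟩
    obtain ⟨g, hg⟩ : X - C c ∣ h + 2 * X * p * C r + X * q * C r ^ 2 := by
      rw [dvd_iff_isRoot, IsRoot.def]
      simp only [eval_add, eval_mul, eval_pow, eval_X, eval_C, eval_ofNat]
      linear_combination hr
    exact ⟨g, by linear_combination hp + q * hg⟩

open Polynomial in
/-- An injective endomorphism of a finite-dimensional space over an algebraically closed field of
characteristic different from two has an inverse square root that is a polynomial in it. -/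
theorem Module.End.exists_mul_aeval_sq_eq_one {K V : Type*} [Field K] [IsAlgClosed K]
    (h2 : (2 : K) ≠ 0) [AddCommGroup V] [Module K V] [FiniteDimensional K V]
    (T : Module.End K V) (hT : Function.Injective T) :
    ∃ p : K[X], T * aeval T p ^ 2 = 1 := by
  obtain ⟨p, hp⟩ := exists_prod_X_sub_C_dvd_X_mul_sq_sub_one h2 (minpoly K T).roots (by
    rintro c hc rfl
    obtain ⟨v, hv⟩ :=
      (Module.End.hasEigenvalue_of_isRoot (isRoot_of_mem_roots hc)).exists_hasEigenvector
    exact hv.2 (hT (by simpa using hv.apply_eq_smul)))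
  refine ⟨p, ?_⟩
  rw [← (IsAlgClosed.splits _).eq_prod_roots_of_monic
    (minpoly.monic (Algebra.IsIntegral.isIntegral T))] at hp
  simpa [sub_eq_zero] using (minpoly.dvd_iff.mp hp)

/-- Whatever commutes with `x` commutes with every polynomial in `x`. -/
theorem Commute.aeval_left {R B : Type*} [CommSemiring R] [Semiring B] [Algebra R B] {x y : B}
    (h : Commute x y) (p : Polynomial R) : Commute (Polynomial.aeval x p) y := by
  induction p using Polynomial.induction_on' with
  | add p q hp hq => simpa using hp.add_left hq
  | monomial n r =>
    rw [Polynomial.aeval_monomial]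
    exact (Algebra.commute_algebraMap_left r y).mul_left (h.pow_left n)

/-- let `𝕜` be algebraically closed of characteristic `≠ 2`, `A` a
`𝕜`-algebra, `ι` a `𝕜`-algebra automorphism of `A` with `ι ∘ ι = id`, and `M` an
`A`-module finite-dimensional over `𝕜`. If there is a bijective `𝕜`-linear map
`α : M → M` with `α (a • m) = ι a • α m`, then there is such a map `α'` which
additionally satisfies `α' ∘ α' = id`. -/
theorem statement19 {𝕜 : Type*} [Field 𝕜] [IsAlgClosed 𝕜] (hchar : ringChar 𝕜 ≠ 2)
    {A : Type*} [Ring A] [Algebra 𝕜 A]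
    (ι : A ≃ₐ[𝕜] A) (hι : ∀ a, ι (ι a) = a)
    {M : Type*} [AddCommGroup M] [Module 𝕜 M] [Module A M] [IsScalarTower 𝕜 A M]
    [FiniteDimensional 𝕜 M]
    (α : M ≃ₗ[𝕜] M) (hα : ∀ (a : A) (m : M), α (a • m) = ι a • α m) :
    ∃ α' : M ≃ₗ[𝕜] M, (∀ (a : A) (m : M), α' (a • m) = ι a • α' m) ∧
      ∀ m, α' (α' m) = m := by
  have h2 : (2 : 𝕜) ≠ 0 := Ring.two_ne_zero hchar
  set S : Module.End 𝕜 M := α.toLinearMap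
  obtain ⟨p, hp⟩ := Module.End.exists_mul_aeval_sq_eq_one h2 (S * S)
    (α.injective.comp α.injective)
  set P := Polynomial.aeval (S * S) p
  have hcomm : Commute P S := ((Commute.refl S).mul_left (Commute.refl S)).aeval_left p
  have hPA : ∀ (a : A) (m : M), P (a • m) = a • P m := by
    intro a
    let L : Module.End 𝕜 M := Algebra.lsmul 𝕜 𝕜 M a
    have hL : Commute (S * S) L := LinearMap.ext fun m => by
      simp [L, S, hα, hι]
    intro m
    exact LinearMap.congr_fun (hL.aeval_left p) m
  have hinv : (S * P) * (S * P) = 1 := by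
    rw [← hp, hcomm.mul_mul_mul_comm, sq]
  have hinv' : ∀ m, (S * P) ((S * P) m) = m := fun m => LinearMap.congr_fun hinv m
  refine ⟨LinearEquiv.ofInvolutive (S * P) hinv', fun a m => ?_, hinv'⟩
  change α (P (a • m)) = ι a • α (P m)
  rw [hPA, hα]
end
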